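/- arXiv:2506.19868 — 14 statements merged into one kernel-verified Lean document; each statement's English description precedes it below -/
import Mathlib

section
/- Every 2×2 doubly nonnegative integer matrix A can be decomposed as A = B * Bᵀ where B is a 2×10 matrix with nonnegative integer entries. Equivalently, for every a, b, c ∈ ℕ with a*c ≥ b², there exists a matrix B : Matrix (Fin 2) (Fin 10) ℕ such that B * Bᵀ = !![a, b; b, c]. -/
open Matrix

/-- `!![a, b; b, c]` is the Gram matrix of two vectors in `ℕ¹⁰`. -/
def IsGramTen (a b c : ℕ) : Prop :=
  ∃ x y : Fin 10 → ℕ, x ⬝ᵥ x = a ∧ x ⬝ᵥ y = b ∧ y ⬝ᵥ y = c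

namespace IsGramTen

theorem symm {a b c : ℕ} (h : IsGramTen a b c) : IsGramTen c b a := by
  obtain ⟨x, y, hx, hxy, hy⟩ := h
  exact ⟨y, x, hy, by rw [dotProduct_comm, hxy], hx⟩

theorem shear {a b c : ℕ} (h : IsGramTen a b c) : IsGramTen (a + 2 * b + c) (b + c) c := by
  obtain ⟨x, y, hx, hxy, hy⟩ := h
  refine ⟨x + y, y, ?_, ?_, hy⟩
  · simp only [add_dotProduct, dotProduct_add, dotProduct_comm y x, hx, hxy, hy]
    ring
  · simp only [add_dotProduct, hxy, hy]

/-- Two columns produce the off-diagonal entry; four squares fill up each diagonal entry. -/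
theorem of_two_columns {a c : ℕ} (x₁ x₂ y₁ y₂ : ℕ) (ha : x₁ ^ 2 + x₂ ^ 2 ≤ a)
    (hc : y₁ ^ 2 + y₂ ^ 2 ≤ c) : IsGramTen a (x₁ * y₁ + x₂ * y₂) c := by
  obtain ⟨d, rfl⟩ := Nat.exists_eq_add_of_le ha
  obtain ⟨e, rfl⟩ := Nat.exists_eq_add_of_le hc
  obtain ⟨p, q, r, s, rfl⟩ := Nat.sum_four_squares d
  obtain ⟨p', q', r', s', rfl⟩ := Nat.sum_four_squares e
  refine ⟨![x₁, x₂, p, q, r, s, 0, 0, 0, 0], ![y₁, y₂, 0, 0, 0, 0, p', q', r', s'], ?_, ?_, ?_⟩ <;>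
  · simp [dotProduct, Fin.sum_univ_succ]
    try ring

/-- Four columns proportional to `(1, 1)`, four proportional to `(0, 1)`, and the columns `(t, 0)`
and `(u, v)`. -/
theorem of_common_part (n m t u v : ℕ) :
    IsGramTen (n + t ^ 2 + u ^ 2) (n + u * v) (n + m + v ^ 2) := by
  obtain ⟨p, q, r, s, rfl⟩ := Nat.sum_four_squares n
  obtain ⟨p', q', r', s', rfl⟩ := Nat.sum_four_squares m
  refine ⟨![p, q, r, s, t, u, 0, 0, 0, 0], ![p, q, r, s, 0, v, p', q', r', s'], ?_, ?_, ?_⟩ <;>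
  · simp [dotProduct, Fin.sum_univ_succ]
    ring

theorem of_two_mul_le {a b c : ℕ} (ha : 2 * b ≤ a) (hc : 2 * b ≤ c) : IsGramTen a b c := by
  obtain ⟨t, j, hj, rfl⟩ : ∃ t j, j ≤ 2 * t ∧ b = t ^ 2 + j :=
    ⟨b.sqrt, b - b.sqrt ^ 2, by have := b.sqrt_le_add; grind, by have := b.sqrt_le'; omega⟩
  rcases Nat.eq_zero_or_pos t with rfl | ht
  · obtain rfl : j = 0 := by omega
    simpa using of_two_columns (a := a) (c := c) 0 0 0 0 (by simp) (by simp)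
  rcases le_or_gt j t with hjt | hjt
  · have := of_two_columns (a := a) (c := c) t j t 1 (by nlinarith) (by nlinarith)
    convert this using 1
    ring
  · obtain ⟨i, rfl⟩ := Nat.exists_eq_add_of_lt hjt
    have := of_two_columns (a := a) (c := c) t (i + 1) (t + 1) 1 (by nlinarith) (by nlinarith)
    convert this using 1
    ring

theorem of_excess_le {b d e : ℕ} (hb : d ≤ b) (he : d ≤ e) : IsGramTen (b + d) b (b + e) := by
  obtain ⟨t, j, hj, rfl⟩ : ∃ t j, j ≤ 2 * t ∧ d = t ^ 2 + j :=
    ⟨d.sqrt, d - d.sqrt ^ 2, by have := d.sqrt_le_add; grind, by have := d.sqrt_le'; omega⟩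
  rcases Nat.eq_zero_or_pos j with rfl | hj0
  · simpa using of_common_part b e t 0 0
  rcases le_or_gt j (t + 1) with hjt | hjt
  · obtain ⟨i, rfl⟩ : ∃ i, j = i + 1 := ⟨j - 1, by omega⟩
    obtain ⟨n, rfl⟩ : ∃ n, b = (i + 1) * i + n := Nat.exists_eq_add_of_le (by nlinarith)
    convert of_common_part n (e + i) t (i + 1) i using 1 <;> ring
  · obtain ⟨i, hi⟩ : ∃ i, j + i = 2 * t + 1 := ⟨2 * t + 1 - j, by omega⟩
    have hit : i + 1 ≤ t := by omega
    obtain ⟨n, rfl⟩ : ∃ n, b = i * (i + 1) + n := Nat.exists_eq_add_of_le (by nlinarith)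
    obtain ⟨m, rfl⟩ : ∃ m, e = i + 1 + m := Nat.exists_eq_add_of_le (by nlinarith)
    convert of_common_part n m (t + 1) i (i + 1) using 1
    · linear_combination hi
    · ring
    · ring

theorem of_le {a b c : ℕ} (ha : b ≤ a) (hc : b ≤ c) : IsGramTen a b c := by
  obtain ⟨d, rfl⟩ := Nat.exists_eq_add_of_le ha
  obtain ⟨e, rfl⟩ := Nat.exists_eq_add_of_le hc
  by_cases hde : d ≤ b ∧ d ≤ e
  · exact of_excess_le hde.1 hde.2
  by_cases hed : e ≤ b ∧ e ≤ d
  · exact (of_excess_le hed.1 hed.2).symm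
  exact of_two_mul_le (by omega) (by omega)

theorem of_sq_le_mul {a b c : ℕ} (h : b ^ 2 ≤ a * c) : IsGramTen a b c := by
  induction hn : a + c using Nat.strong_induction_on generalizing a b c with
  | _ n ih =>
    have step : ∀ {a b c : ℕ}, b ^ 2 ≤ a * c → a + c = n → c < b → IsGramTen a b c := by
      intro a b c h hn hcb
      obtain ⟨k, rfl⟩ := Nat.exists_eq_add_of_le' hcb.le
      have hc : 0 < c := by
        rcases Nat.eq_zero_or_pos c with rfl | hc
        · nlinarith
        · exact hc
      obtain ⟨a', rfl⟩ : ∃ a', a = a' + (2 * k + c) := Nat.exists_eq_add_of_le' <| by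
        by_contra! hlt
        nlinarith
      have := (ih (a' + c) (by omega) (a := a') (b := k) (c := c) (by nlinarith) rfl).shear
      rwa [add_assoc] at this
    rcases lt_or_ge c b with hcb | hcb
    · exact step h hn hcb
    rcases lt_or_ge a b with hab | hab
    · exact (step (by rwa [mul_comm]) (by omega) hab).symm
    exact of_le hab hcb

end IsGramTen

theorem icpr_le_ten (a b c : ℕ) (h : b ^ 2 ≤ a * c) :
    ∃ B : Matrix (Fin 2) (Fin 10) ℕ, B * Bᵀ = !![a, b; b, c] := by
  obtain ⟨x, y, hx, hxy, hy⟩ := IsGramTen.of_sq_le_mul h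
  refine ⟨of ![x, y], ?_⟩
  ext i j
  have hyx : y ⬝ᵥ x = b := by rw [dotProduct_comm, hxy]
  rw [mul_apply']
  fin_cases i <;> fin_cases j
  exacts [hx, hxy, hyx, hy]
end

section
/- If A = !![a, b; b, c] is a 2×2 doubly nonnegative integer matrix (a, b, c ∈ ℕ with a*c ≥ b²) and a ≤ 64, then A can be decomposed as A = B * Bᵀ where B is a 2×9 matrix with nonnegative integer entries. -/
open Matrix

/-- `!![a, b; b, c]` is a product `B * Bᵀ` with `n` columns, in coordinates. -/
def HasFactorization (n a b c : ℕ) : Prop :=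
  ∃ x y : Fin n → ℕ, ∑ i, x i ^ 2 = a ∧ ∑ i, x i * y i = b ∧ ∑ i, y i ^ 2 = c

namespace HasFactorization

variable {m n a b c a' b' c' : ℕ}

theorem swap (h : HasFactorization n a b c) : HasFactorization n c b a := by
  obtain ⟨x, y, hx, hxy, hy⟩ := h
  exact ⟨y, x, hy, by simpa only [mul_comm] using hxy, hx⟩

theorem shear (h : HasFactorization n a b c) :
    HasFactorization n a (b + a) (c + 2 * b + a) := by
  obtain ⟨x, y, rfl, rfl, rfl⟩ := h
  refine ⟨x, fun i => y i + x i, rfl, ?_, ?_⟩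
  · rw [← Finset.sum_add_distrib]
    exact Finset.sum_congr rfl fun i _ => by ring
  · rw [Finset.mul_sum, ← Finset.sum_add_distrib, ← Finset.sum_add_distrib]
    exact Finset.sum_congr rfl fun i _ => by ring

theorem add (h : HasFactorization m a b c) (h' : HasFactorization n a' b' c') :
    HasFactorization (m + n) (a + a') (b + b') (c + c') := by
  obtain ⟨x, y, rfl, rfl, rfl⟩ := h
  obtain ⟨x', y', rfl, rfl, rfl⟩ := h'
  exact ⟨Fin.append x x', Fin.append y y', by simp [Fin.sum_univ_add],
    by simp [Fin.sum_univ_add], by simp [Fin.sum_univ_add]⟩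

theorem exists_matrix (h : HasFactorization n a b c) :
    ∃ B : Matrix (Fin 2) (Fin n) ℕ, B * Bᵀ = !![a, b; b, c] := by
  obtain ⟨x, y, rfl, rfl, rfl⟩ := h
  refine ⟨Matrix.of ![x, y], ?_⟩
  ext i j
  fin_cases i <;> fin_cases j <;> simp [Matrix.mul_apply, sq, mul_comm]

end HasFactorization

theorem hasFactorization_four_zero_zero (c : ℕ) : HasFactorization 4 0 0 c := by
  obtain ⟨p, q, r, s, h⟩ := Nat.sum_four_squares c
  exact ⟨0, ![p, q, r, s], by simp, by simp, by simpa [Fin.sum_univ_four] using h⟩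

/-- Every `b ≤ ∑ i, x i ^ 2` has the form `∑ i, x i * y i` with `0 ≤ y ≤ x`. -/
def CoversInnerProducts {n : ℕ} (x : Fin n → ℕ) : Prop :=
  ∀ b ≤ ∑ i, x i ^ 2, ∃ y ≤ x, ∑ i, x i * y i = b

theorem coversInnerProducts_empty : CoversInnerProducts ![] := by
  intro b hb
  exact ⟨![], le_rfl, by simpa using hb.antisymm' (Nat.zero_le _)⟩

theorem CoversInnerProducts.cons {n p : ℕ} {x : Fin n → ℕ} (hx : CoversInnerProducts x)
    (hp : p ≤ ∑ i, x i ^ 2 + 1) : CoversInnerProducts (vecCons p x) := by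
  intro b hb
  obtain ⟨q, hq, r, hr, rfl⟩ : ∃ q ≤ p, ∃ r ≤ ∑ i, x i ^ 2, b = p * q + r := by
    have hb' : b ≤ p ^ 2 + ∑ i, x i ^ 2 := by simpa [Fin.sum_univ_succ] using hb
    by_cases h : p ^ 2 ≤ b
    · exact ⟨p, le_rfl, b - p ^ 2, by omega, by rw [← sq]; omega⟩
    · have hp0 : 0 < p := by
        by_contra! h0
        simp_all
      have := Nat.mod_lt b hp0
      exact ⟨b / p, (Nat.div_lt_of_lt_mul (by rw [← sq]; omega)).le, b % p, by omega,
        (Nat.div_add_mod b p).symm⟩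
  obtain ⟨y, hy, hxy⟩ := hx r hr
  refine ⟨vecCons q y, ?_, by simp [Fin.sum_univ_succ, hxy]⟩
  intro i
  refine Fin.cases ?_ (fun j => ?_) i
  · simpa using hq
  · simpa using hy j

theorem exists_five_squares_of_le_64 (a : ℕ) (ha : a ≤ 64) (h33 : a ≠ 33) :
    ∃ x₁ ≤ 1, ∃ x₂ ≤ 2, ∃ x₃ ≤ 8, ∃ x₄ ≤ 8, ∃ x₅ ≤ 8,
      x₅ ^ 2 + (x₄ ^ 2 + (x₃ ^ 2 + (x₂ ^ 2 + x₁ ^ 2))) = a ∧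
      x₂ ≤ x₁ ^ 2 + 1 ∧ x₃ ≤ x₂ ^ 2 + x₁ ^ 2 + 1 ∧ x₄ ≤ x₃ ^ 2 + (x₂ ^ 2 + x₁ ^ 2) + 1 ∧
      x₅ ≤ x₄ ^ 2 + (x₃ ^ 2 + (x₂ ^ 2 + x₁ ^ 2)) + 1 := by
  revert a
  decide +kernel

theorem exists_coversInnerProducts_of_le_64 {a : ℕ} (ha : a ≤ 64) (h33 : a ≠ 33) :
    ∃ x : Fin 5 → ℕ, CoversInnerProducts x ∧ ∑ i, x i ^ 2 = a := by
  obtain ⟨x₁, h₁, x₂, -, x₃, -, x₄, -, x₅, -, hsum, h₂, h₃, h₄, h₅⟩ :=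
    exists_five_squares_of_le_64 a ha h33
  refine ⟨![x₅, x₄, x₃, x₂, x₁], ?_, by simpa [Fin.sum_univ_succ] using hsum⟩
  refine ((((coversInnerProducts_empty.cons ?_).cons ?_).cons ?_).cons ?_).cons ?_ <;>
    simpa [Fin.sum_univ_succ]

/-- No single representation of 33 as a sum of five squares covers all `b ≤ 33`:
`b = 1` and `b = 32` are treated apart. -/
theorem exists_inner_eq_of_le_33 {b : ℕ} (hb : b ≤ 33) :
    ∃ x y : Fin 5 → ℕ, y ≤ x ∧ ∑ i, x i ^ 2 = 33 ∧ ∑ i, x i * y i = b := by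
  by_cases h₁ : b = 1
  · exact ⟨![4, 4, 1, 0, 0], ![0, 0, 1, 0, 0], by simp [Pi.le_def, Fin.forall_fin_succ], by decide,
      by rw [h₁]; decide⟩
  by_cases h₂ : b = 32
  · exact ⟨![4, 4, 1, 0, 0], ![4, 4, 0, 0, 0], by simp [Pi.le_def, Fin.forall_fin_succ], by decide,
      by rw [h₂]; decide⟩
  have key : ∀ b ≤ 33, b ≠ 1 → b ≠ 32 → ∃ p ≤ 4, ∃ q ≤ 3, ∃ r ≤ 2, ∃ s ≤ 2,
      4 * p + (3 * q + (2 * r + 2 * s)) = b := by decide +kernel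
  obtain ⟨p, hp, q, hq, r, hr, s, hs, hsum⟩ := key b hb h₁ h₂
  refine ⟨![4, 3, 2, 2, 0], ![p, q, r, s, 0], ?_, by decide,
    by simpa [Fin.sum_univ_succ] using hsum⟩
  intro i
  fin_cases i <;> simp [*]

theorem exists_inner_eq_of_le_64 {a b : ℕ} (ha : a ≤ 64) (hb : b ≤ a) :
    ∃ x y : Fin 5 → ℕ, y ≤ x ∧ ∑ i, x i ^ 2 = a ∧ ∑ i, x i * y i = b := by
  by_cases h33 : a = 33
  · subst h33
    exact exists_inner_eq_of_le_33 hb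
  · obtain ⟨x, hx, rfl⟩ := exists_coversInnerProducts_of_le_64 ha h33
    obtain ⟨y, hy, hxy⟩ := hx b hb
    exact ⟨x, y, hy, rfl, hxy⟩

theorem hasFactorization_nine_of_le {a b c : ℕ} (ha : a ≤ 64) (hb : b ≤ a) (hc : a ≤ c) :
    HasFactorization 9 a b c := by
  obtain ⟨x, y, hy, rfl, rfl⟩ := exists_inner_eq_of_le_64 ha hb
  have hyc : ∑ i, y i ^ 2 ≤ c :=
    (Finset.sum_le_sum fun i _ => Nat.pow_le_pow_left (hy i) 2).trans hc
  have h₀ : HasFactorization 5 _ _ _ := ⟨x, y, rfl, rfl, rfl⟩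
  convert h₀.add (hasFactorization_four_zero_zero (c - ∑ i, y i ^ 2)) using 1 <;>
    omega

theorem hasFactorization_nine_of_le_64 (a b c : ℕ) (h : b ^ 2 ≤ a * c) (ha : a ≤ 64) :
    HasFactorization 9 a b c := by
  induction hs : a + b + c using Nat.strong_induction_on generalizing a b c with
  | _ s ih =>
    rcases lt_or_ge c a with hca | hac
    · rcases le_or_gt b c with hbc | hcb
      · exact (hasFactorization_nine_of_le (by omega) hbc hca.le).swap
      · rcases Nat.eq_zero_or_pos c with rfl | hc
        · simp_all
        have hle : 2 * b ≤ a + c := by nlinarith [sq_nonneg ((a : ℤ) - c)]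
        obtain ⟨d, rfl⟩ := Nat.exists_eq_add_of_lt hcb
        obtain ⟨e, rfl⟩ := Nat.exists_eq_add_of_le (show c + 2 * (d + 1) ≤ a by omega)
        have := (ih (e + (d + 1) + c) (by omega) e (d + 1) c (by nlinarith) (by omega) rfl)
        convert this.swap.shear.swap using 1 <;> omega
    · rcases le_or_gt b a with hba | hab
      · exact hasFactorization_nine_of_le ha hba hac
      · rcases Nat.eq_zero_or_pos a with rfl | ha0
        · simp_all
        have hle : 2 * b ≤ a + c := by nlinarith [sq_nonneg ((a : ℤ) - c)]
        obtain ⟨d, rfl⟩ := Nat.exists_eq_add_of_lt hab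
        obtain ⟨e, rfl⟩ := Nat.exists_eq_add_of_le (show a + 2 * (d + 1) ≤ c by omega)
        have := (ih (a + (d + 1) + e) (by omega) a (d + 1) e (by nlinarith) ha rfl)
        convert this.shear using 1 <;> omega

theorem icpr_le_nine_of_le_64 (a b c : ℕ) (h : b ^ 2 ≤ a * c) (ha : a ≤ 64) :
    ∃ B : Matrix (Fin 2) (Fin 9) ℕ, B * Bᵀ = !![a, b; b, c] :=
  (hasFactorization_nine_of_le_64 a b c h ha).exists_matrix
end

section
/- (Laffey–Šmigoc, 2019) Every 2×2 doubly nonnegative integer matrix A can be decomposed as A = B * Bᵀ where B is a 2×11 matrix with nonnegative integer entries, i.e., icpr(A) ≤ 11. -/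
open Matrix

/-- Balanced division. -/
theorem Int.exists_abs_two_mul_add_le (a b : ℤ) (ha : 0 < a) : ∃ k : ℤ, |2 * (b + k * a)| ≤ a := by
  refine ⟨-((2 * b + a) / (2 * a)), ?_⟩
  have h₁ := Int.emod_nonneg (2 * b + a) (b := 2 * a) (by omega)
  have h₂ := Int.emod_lt_of_pos (2 * b + a) (b := 2 * a) (by omega)
  have h₃ := Int.mul_ediv_add_emod (2 * b + a) (2 * a)
  rw [abs_le]
  constructor <;> nlinarith

/-- The inequalities satisfied by a reduced ternary form of determinant one. -/
theorem eq_one_of_reduced {a b f g h : ℤ} (ha : 0 < a) (hg : 0 < a * b - f ^ 2) (hab : a ≤ b)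
    (hgg : a * b - f ^ 2 ≤ g) (hf : |2 * f| ≤ a) (hh : |2 * h| ≤ a * b - f ^ 2)
    (hdisc : (a * b - f ^ 2) * g - h ^ 2 = a) : a = 1 ∧ a * b - f ^ 2 = 1 := by
  have hf2 := sq_le_sq' (abs_le.1 hf).1 (abs_le.1 hf).2
  have h₁ : 3 * a ^ 2 ≤ 4 * (a * b - f ^ 2) := by
    linarith [mul_le_mul_of_nonneg_left hab ha.le]
  generalize a * b - f ^ 2 = t at *
  have hh2 := sq_le_sq' (abs_le.1 hh).1 (abs_le.1 hh).2
  have h₂ : 3 * t ^ 2 ≤ 4 * a := by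
    linarith [mul_le_mul_of_nonneg_left hgg hg.le]
  rcases le_total a t with h | h
  · have ht : t = 1 := by nlinarith
    omega
  · have ha1 : a = 1 := by nlinarith
    omega

/-- A positive definite ternary form with integral symmetric matrix of determinant one represents
only sums of three squares. -/
theorem ternary_unimodular_eq_sum_three_squares (a b c d e f : ℤ) (ha : 0 < a)
    (hg : 0 < a * b - f ^ 2)
    (hD : a * b * c + 2 * d * e * f - a * d ^ 2 - b * e ^ 2 - c * f ^ 2 = 1) (x y z : ℤ) :
    ∃ u v w : ℤ, a * x ^ 2 + b * y ^ 2 + c * z ^ 2 + 2 * d * y * z + 2 * e * x * z + 2 * f * x * y =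
      u ^ 2 + v ^ 2 + w ^ 2 := by
  -- reduce the second, then the third basis vector
  obtain ⟨k, hk⟩ := Int.exists_abs_two_mul_add_le a f ha
  obtain ⟨l, hl⟩ := Int.exists_abs_two_mul_add_le (a * b - f ^ 2) (a * d - e * f) hg
  obtain ⟨b', hb'⟩ : ∃ t, t = b + 2 * k * f + k ^ 2 * a := ⟨_, rfl⟩
  obtain ⟨f', hf'⟩ : ∃ t, t = f + k * a := ⟨_, rfl⟩
  obtain ⟨e', he'⟩ : ∃ t, t = e + l * f' := ⟨_, rfl⟩
  obtain ⟨d', hd'⟩ : ∃ t, t = d + k * e + l * b' := ⟨_, rfl⟩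
  obtain ⟨c', hc'⟩ : ∃ t, t = c + 2 * l * (d + k * e) + l ^ 2 * b' := ⟨_, rfl⟩
  have hg' : a * b - f ^ 2 = a * b' - f' ^ 2 := by subst hb' hf'; ring
  have hgl : a * d - e * f + l * (a * b - f ^ 2) = a * d' - e' * f' := by
    subst hd' he' hb' hf'; ring
  have hD' : a * b' * c' + 2 * d' * e' * f' - a * d' ^ 2 - b' * e' ^ 2 - c' * f' ^ 2 = 1 := by
    rw [← hD]; subst hc' hd' he' hb' hf'; ring
  have hval : a * x ^ 2 + b * y ^ 2 + c * z ^ 2 + 2 * d * y * z + 2 * e * x * z + 2 * f * x * y =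
      a * (x - k * y) ^ 2 + b' * (y - l * z) ^ 2 + c' * z ^ 2 +
        2 * d' * (y - l * z) * z + 2 * e' * (x - k * y) * z +
        2 * f' * (x - k * y) * (y - l * z) := by
    subst hc' hd' he' hb' hf'; ring
  rw [hgl] at hl
  rw [← hf'] at hk
  rw [hg'] at hl
  have hgp : 0 < a * b' - f' ^ 2 := hg' ▸ hg
  have hdisc : (a * b' - f' ^ 2) * (a * c' - e' ^ 2) - (a * d' - e' * f') ^ 2 = a := by
    linear_combination a * hD'
  have hb'pos : 0 < b' := by
    have : 0 < a * b' := by linarith [sq_nonneg f']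
    exact (pos_iff_pos_of_mul_pos this).1 ha
  have hg2pos : 0 < a * c' - e' ^ 2 := by
    have : 0 < (a * b' - f' ^ 2) * (a * c' - e' ^ 2) := by
      linarith [sq_nonneg (a * d' - e' * f')]
    exact (pos_iff_pos_of_mul_pos this).1 hgp
  rw [hval]
  generalize x - k * y = X
  generalize y - l * z = Y
  by_cases hba : b' < a
  · obtain ⟨u, v, w, h⟩ := ternary_unimodular_eq_sum_three_squares b' a c' e' d' f' hb'pos
      (by linarith) (by linarith) Y X z
    exact ⟨u, v, w, by linarith⟩
  by_cases hgg : a * c' - e' ^ 2 < a * b' - f' ^ 2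
  · obtain ⟨u, v, w, h⟩ := ternary_unimodular_eq_sum_three_squares a c' b' d' f' e' ha
      hg2pos (by linarith) X z Y
    exact ⟨u, v, w, by linarith⟩
  push Not at hba hgg
  -- the reduced form is the identity, up to one last translation
  obtain ⟨ha1, hG1⟩ := eq_one_of_reduced ha hgp hba hgg hk hl hdisc
  subst ha1
  rw [hG1] at hl
  have hf0 : f' = 0 := by rw [abs_le] at hk; omega
  subst hf0
  have hb1 : b' = 1 := by linarith
  have hd0 : d' = 0 := by rw [abs_le] at hl; omega
  subst hd0 hb1
  refine ⟨X + e' * z, Y, z, ?_⟩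
  linear_combination z ^ 2 * hD'
termination_by (a.toNat, (a * b - f ^ 2).toNat)
decreasing_by
  · apply Prod.Lex.left; omega
  · apply Prod.Lex.right; omega

/-- Dirichlet's criterion for sums of three squares. -/
theorem Nat.eq_sum_three_squares_of_dvd {n d q : ℕ} (hd : 0 < d) (hq : 0 < q)
    (h : q + 1 = d * n) (t : ℤ) (ht : (q : ℤ) ∣ t ^ 2 + d) :
    ∃ u v w : ℕ, n = u ^ 2 + v ^ 2 + w ^ 2 := by
  obtain ⟨s, hs⟩ := ht
  zify at hd hq h
  have hs0 : 0 < s := by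
    by_contra! hcon
    nlinarith [sq_nonneg t, mul_nonneg hq.le (neg_nonneg.2 hcon)]
  obtain ⟨u, v, w, h⟩ := ternary_unimodular_eq_sum_three_squares s q n 0 1 t hs0
    (by linarith) (by linear_combination -h - n * hs) 0 0 1
  refine ⟨u.natAbs, v.natAbs, w.natAbs, ?_⟩
  zify
  simp only [sq_abs]
  linarith

open NumberTheorySymbols in
theorem Nat.eq_sum_three_squares_of_mod_four_eq_two {n : ℕ} (hn : n % 4 = 2) :
    ∃ u v w : ℕ, n = u ^ 2 + v ^ 2 + w ^ 2 := by
  have hco : (n - 1).Coprime (4 * n) := by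
    apply Nat.Coprime.mul_right
    · exact Nat.Coprime.pow_right 2 ((Nat.coprime_two_right).2 (Nat.odd_iff.2 (by omega)))
    · exact (Nat.coprime_self_sub_left (by omega)).2 (by simp)
  obtain ⟨p, hp, hpp, hpm⟩ := Nat.forall_exists_prime_gt_and_modEq n (by omega) hco
  have := Fact.mk hpp
  obtain ⟨m, hm⟩ := (Nat.modEq_iff_dvd' (by omega)).1 hpm.symm
  have hdn : p + 1 = (4 * m + 1) * n := by
    have : p = 4 * n * m + (n - 1) := by omega
    rw [this, add_assoc, Nat.sub_add_cancel (by omega)]; ring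
  have hp4 : p % 4 = 1 := by
    have : p = 4 * (n * m) + (n - 1) := by rw [← mul_assoc]; omega
    omega
  have hsq : IsSquare (((-((4 * m + 1 : ℕ) : ℤ)) : ℤ) : ZMod p) := by
    apply ZMod.isSquare_of_jacobiSym_eq_one
    rw [jacobiSym.neg _ (Nat.odd_iff.2 (by omega)), ZMod.χ₄_nat_one_mod_four hp4, one_mul,
      jacobiSym.quadratic_reciprocity_one_mod_four (by omega) (Nat.odd_iff.2 (by omega))]
    have hmod : (p : ℤ) % (4 * m + 1 : ℕ) = (-1) % (4 * m + 1 : ℕ) := by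
      apply Int.ModEq.symm
      rw [Int.modEq_iff_dvd]
      exact ⟨n, by zify at hdn; push_cast; linarith⟩
    rw [jacobiSym.mod_left, hmod, ← jacobiSym.mod_left,
      jacobiSym.at_neg_one (Nat.odd_iff.2 (by omega)), ZMod.χ₄_nat_one_mod_four (by omega)]
  obtain ⟨r, hr⟩ := hsq
  obtain ⟨t, rfl⟩ := ZMod.intCast_surjective r
  refine Nat.eq_sum_three_squares_of_dvd (by omega) hpp.pos hdn t ?_
  rw [← ZMod.intCast_zmod_eq_zero_iff_dvd]
  push_cast at hr ⊢
  linear_combination -hr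

open NumberTheorySymbols in
theorem Nat.eq_sum_three_squares_of_mod_four_eq_one {n : ℕ} (hn : n % 4 = 1) :
    ∃ u v w : ℕ, n = u ^ 2 + v ^ 2 + w ^ 2 := by
  obtain ⟨a, ha⟩ : ∃ a, 2 * a + 1 = 3 * n := ⟨(3 * n - 1) / 2, by omega⟩
  have hco : a.Coprime (4 * n) := by
    apply Nat.Coprime.mul_right
    · exact Nat.Coprime.pow_right 2 ((Nat.coprime_two_right).2 (Nat.odd_iff.2 (by omega)))
    · rw [← Nat.isCoprime_iff_coprime]
      exact ⟨-2, 3, by zify at ha; linarith⟩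
  obtain ⟨p, hp, hpp, hpm⟩ := Nat.forall_exists_prime_gt_and_modEq a (by omega) hco
  have := Fact.mk hpp
  obtain ⟨m, hm⟩ := (Nat.modEq_iff_dvd' (by omega)).1 hpm.symm
  have hpa : p = 4 * (n * m) + a := by rw [← mul_assoc]; omega
  have hdn : 2 * p + 1 = (8 * m + 3) * n := by
    rw [hpa]; linarith
  have hodd : Odd (8 * m + 3) := Nat.odd_iff.2 (by omega)
  have hpodd : Odd p := Nat.odd_iff.2 (by omega)
  have hpd : J((p : ℤ) | 8 * m + 3) = 1 := by
    have hmod : (2 * p : ℤ) % (8 * m + 3 : ℕ) = (-1) % (8 * m + 3 : ℕ) := by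
      apply Int.ModEq.symm
      rw [Int.modEq_iff_dvd]
      exact ⟨n, by zify at hdn; push_cast; linarith⟩
    have h : J(2 * (p : ℤ) | 8 * m + 3) = J(-1 | 8 * m + 3) := by
      rw [jacobiSym.mod_left, hmod, ← jacobiSym.mod_left]
    rw [jacobiSym.mul_left, jacobiSym.at_two hodd, jacobiSym.at_neg_one hodd,
      ZMod.χ₄_nat_three_mod_four (by omega), ZMod.χ₈_nat_eq_if_mod_eight,
      if_neg (by omega), if_neg (by omega)] at h
    linarith
  have hsq : IsSquare (((-((8 * m + 3 : ℕ) : ℤ)) : ℤ) : ZMod p) := by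
    apply ZMod.isSquare_of_jacobiSym_eq_one
    rw [jacobiSym.neg _ hpodd]
    rcases (by omega : p % 4 = 1 ∨ p % 4 = 3) with hp4 | hp4
    · rw [ZMod.χ₄_nat_one_mod_four hp4, one_mul,
        ← jacobiSym.quadratic_reciprocity_one_mod_four hp4 hodd, hpd]
    · rw [ZMod.χ₄_nat_three_mod_four hp4,
        jacobiSym.quadratic_reciprocity_three_mod_four (by omega) hp4, hpd]
      norm_num
  obtain ⟨r, hr⟩ := hsq
  obtain ⟨t, rfl⟩ := ZMod.intCast_surjective r
  have hdvd : (p : ℤ) ∣ t ^ 2 + (8 * m + 3 : ℕ) := by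
    rw [← ZMod.intCast_zmod_eq_zero_iff_dvd]
    push_cast at hr ⊢
    linear_combination -hr
  obtain ⟨t, hdvd, htodd⟩ :
      ∃ t : ℤ, (p : ℤ) ∣ t ^ 2 + (8 * m + 3 : ℕ) ∧ Odd t := by
    rcases Int.even_or_odd t with h | h
    · refine ⟨t + p, ?_, h.add_odd (by exact_mod_cast hpodd)⟩
      have := hdvd.add (dvd_mul_right (p : ℤ) (2 * t + p))
      rwa [show t ^ 2 + (8 * m + 3 : ℕ) + p * (2 * t + p) = (t + p) ^ 2 + (8 * m + 3 : ℕ) by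
        ring] at this
    · exact ⟨t, hdvd, h⟩
  refine Nat.eq_sum_three_squares_of_dvd (by omega) (by have := hpp.pos; omega) hdn t ?_
  push_cast
  refine IsCoprime.mul_dvd ?_ ?_ (by exact_mod_cast hdvd)
  · exact_mod_cast (Nat.coprime_two_left).2 hpodd
  · exact even_iff_two_dvd.1 (htodd.pow.add_odd ⟨4 * m + 1, by ring⟩)

/-- Either `n` or `n - 2` is a sum of three squares. -/
theorem Nat.eq_sum_three_squares_or (n : ℕ) :
    (∃ u v w : ℕ, n = u ^ 2 + v ^ 2 + w ^ 2) ∨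
      ∃ u v w : ℕ, n = u ^ 2 + v ^ 2 + w ^ 2 + 2 := by
  have hlt : n % 4 < 4 := Nat.mod_lt _ (by norm_num)
  rcases Nat.eq_zero_or_pos n with rfl | h0
  · exact Or.inl ⟨0, 0, 0, rfl⟩
  interval_cases hn : n % 4
  · obtain ⟨u, v, w, h⟩ := Nat.eq_sum_three_squares_of_mod_four_eq_two (n := n - 2) (by omega)
    exact Or.inr ⟨u, v, w, by omega⟩
  · exact Or.inl (Nat.eq_sum_three_squares_of_mod_four_eq_one hn)
  · exact Or.inl (Nat.eq_sum_three_squares_of_mod_four_eq_two hn)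
  · obtain ⟨u, v, w, h⟩ := Nat.eq_sum_three_squares_of_mod_four_eq_one (n := n - 2) (by omega)
    exact Or.inr ⟨u, v, w, by omega⟩

/-- A matrix factorization from two nonnegative integer row vectors. -/
theorem exists_mul_transpose_eq_of_rows {k a b c : ℕ} (x y : Fin k → ℕ) (ha : ∑ i, x i * x i = a)
    (hb : ∑ i, x i * y i = b) (hc : ∑ i, y i * y i = c) :
    ∃ B : Matrix (Fin 2) (Fin k) ℕ, B * Bᵀ = !![a, b; b, c] := by
  refine ⟨Matrix.of ![x, y], ?_⟩
  ext i j
  fin_cases i <;> fin_cases j <;> simp [Matrix.mul_apply, ha, hb, hc]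
  simp [← hb, mul_comm]

theorem icpr_le_eleven_of_diagonally_dominant (p b q : ℕ) :
    ∃ B : Matrix (Fin 2) (Fin 11) ℕ, B * Bᵀ = !![p + b, b; b, q + b] := by
  obtain ⟨p₁, p₂, p₃, p₄, hp⟩ := Nat.sum_four_squares p
  obtain ⟨b₁, b₂, b₃, b₄, hb⟩ := Nat.sum_four_squares b
  obtain ⟨q₁, q₂, q₃, q₄, hq⟩ := Nat.sum_four_squares q
  obtain ⟨r₁, r₂, r₃, r₄, hr⟩ := Nat.sum_four_squares (q + 1)
  rcases Nat.eq_sum_three_squares_or p with ⟨u₁, u₂, u₃, hu⟩ | ⟨u₁, u₂, u₃, hu⟩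
  · refine exists_mul_transpose_eq_of_rows ![u₁, u₂, u₃, b₁, b₂, b₃, b₄, 0, 0, 0, 0]
      ![0, 0, 0, b₁, b₂, b₃, b₄, q₁, q₂, q₃, q₄] ?_ ?_ ?_ <;>
    simp [Fin.sum_univ_succ] <;> linarith
  rcases Nat.eq_sum_three_squares_or b with ⟨v₁, v₂, v₃, hv⟩ | ⟨v₁, v₂, v₃, hv⟩
  · refine exists_mul_transpose_eq_of_rows ![p₁, p₂, p₃, p₄, v₁, v₂, v₃, 0, 0, 0, 0]
      ![0, 0, 0, 0, v₁, v₂, v₃, q₁, q₂, q₃, q₄] ?_ ?_ ?_ <;>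
    simp [Fin.sum_univ_succ] <;> linarith
  · refine exists_mul_transpose_eq_of_rows ![u₁, u₂, u₃, v₁, v₂, v₃, 2, 0, 0, 0, 0]
      ![0, 0, 0, v₁, v₂, v₃, 1, r₁, r₂, r₃, r₄] ?_ ?_ ?_ <;>
    simp [Fin.sum_univ_succ] <;> linarith

/-- Exchanging the two rows of a factor exchanges the diagonal entries. -/
theorem exists_mul_transpose_eq_swap {k a b c : ℕ}
    (h : ∃ B : Matrix (Fin 2) (Fin k) ℕ, B * Bᵀ = !![a, b; b, c]) :
    ∃ B : Matrix (Fin 2) (Fin k) ℕ, B * Bᵀ = !![c, b; b, a] := by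
  obtain ⟨B, hB⟩ := h
  have h₀ := congrFun (congrFun hB 0) 0
  have h₁ := congrFun (congrFun hB 1) 0
  have h₂ := congrFun (congrFun hB 1) 1
  simp only [Matrix.mul_apply, Matrix.transpose_apply] at h₀ h₁ h₂
  exact exists_mul_transpose_eq_of_rows (B 1) (B 0) h₂ h₁ h₀

/-- Adding the first row of a factor to the second. -/
theorem exists_mul_transpose_eq_add_row {k a b c : ℕ}
    (h : ∃ B : Matrix (Fin 2) (Fin k) ℕ, B * Bᵀ = !![a, b; b, c]) :
    ∃ B : Matrix (Fin 2) (Fin k) ℕ, B * Bᵀ = !![a, b + a; b + a, c + 2 * b + a] := by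
  obtain ⟨B, hB⟩ := h
  have h₀ := congrFun (congrFun hB 0) 0
  have h₁ := congrFun (congrFun hB 0) 1
  have h₂ := congrFun (congrFun hB 1) 1
  simp [Matrix.mul_apply, Matrix.transpose_apply] at h₀ h₁ h₂
  refine exists_mul_transpose_eq_of_rows (B 0) (B 0 + B 1) h₀ ?_ ?_
  · rw [← h₀, ← h₁, ← Finset.sum_add_distrib]
    exact Finset.sum_congr rfl fun i _ => by simp only [Pi.add_apply]; ring
  · rw [← h₀, ← h₁, ← h₂, Finset.mul_sum, ← Finset.sum_add_distrib, ← Finset.sum_add_distrib]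
    exact Finset.sum_congr rfl fun i _ => by simp only [Pi.add_apply]; ring

theorem icpr_le_eleven (a b c : ℕ) (h : b ^ 2 ≤ a * c) :
    ∃ B : Matrix (Fin 2) (Fin 11) ℕ, B * Bᵀ = !![a, b; b, c] := by
  induction hs : b using Nat.strong_induction_on generalizing a b c with
  | _ s ih =>
    subst hs
    wlog hac : a ≤ c generalizing a c
    · exact exists_mul_transpose_eq_swap (this c a (by linarith) (by omega))
    rcases le_or_gt b a with hba | hab
    · obtain ⟨p, rfl⟩ := Nat.exists_eq_add_of_le' hba
      obtain ⟨q, rfl⟩ := Nat.exists_eq_add_of_le' (hba.trans hac)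
      exact icpr_le_eleven_of_diagonally_dominant p b q
    · have ha : 0 < a := by
        rcases Nat.eq_zero_or_pos a with rfl | ha
        · nlinarith
        · exact ha
      obtain ⟨r, rfl⟩ := Nat.exists_eq_add_of_le' hab.le
      obtain ⟨q, rfl⟩ : ∃ q, c = q + 2 * r + a := by
        have : 2 * r + a ≤ c := by
          by_contra! hc
          nlinarith [Nat.mul_le_mul_left a (Nat.succ_le_of_lt hc), sq_nonneg r]
        exact ⟨c - (2 * r + a), by omega⟩
      exact exists_mul_transpose_eq_add_row (ih r (by omega) a r q (by nlinarith) rfl)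
end

section
/- (Laffey–Šmigoc, 2018) Every 2×2 doubly nonnegative integer matrix is completely positive over the integers: for all a, b, c ∈ ℕ with a*c ≥ b², there exist k ∈ ℕ and a matrix B : Matrix (Fin 2) (Fin k) ℕ such that B * Bᵀ = !![a, b; b, c]. -/
open Matrix

/-- A `2 × 2` doubly nonnegative integer matrix is the Gram matrix of two finitely supported
vectors of natural numbers. Euclidean descent on the off-diagonal entry. -/
theorem exists_nat_vectors_of_sq_le_mul (b : ℕ) : ∀ a c : ℕ, b ^ 2 ≤ a * c →
    ∃ (ι : Type) (_ : Fintype ι) (x y : ι → ℕ),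
      ∑ i, x i * x i = a ∧ ∑ i, x i * y i = b ∧ ∑ i, y i * y i = c := by
  induction b using Nat.strong_induction_on with
  | _ b ih =>
    have descent : ∀ a c : ℕ, b ^ 2 ≤ a * c → a < b →
        ∃ (ι : Type) (_ : Fintype ι) (x y : ι → ℕ),
          ∑ i, x i * x i = a ∧ ∑ i, x i * y i = b ∧ ∑ i, y i * y i = c := by
      intro a c h hab
      have ha : 0 < a := by
        rcases Nat.eq_zero_or_pos a with rfl | ha
        · nlinarith
        · exact ha
      obtain ⟨d, rfl⟩ := Nat.exists_eq_add_of_le hab.le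
      have hc : a + 2 * d ≤ c := by nlinarith [sq_nonneg d]
      obtain ⟨e, rfl⟩ := Nat.exists_eq_add_of_le hc
      obtain ⟨ι, _, x, y, hx, hxy, hy⟩ := ih d (by omega) a e (by nlinarith)
      refine ⟨ι, inferInstance, x, fun i => x i + y i, hx, ?_, ?_⟩
      · simp only [mul_add, Finset.sum_add_distrib, hx, hxy]
      · simp only [mul_add, add_mul, Finset.sum_add_distrib, hx, hxy, hy, mul_comm (y _) (x _)]
        ring
    intro a c h
    rcases lt_or_ge a b with hab | hab
    · exact descent a c h hab
    rcases lt_or_ge c b with hcb | hcb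
    · obtain ⟨ι, _, x, y, hx, hxy, hy⟩ := descent c a (by rwa [mul_comm]) hcb
      exact ⟨ι, inferInstance, y, x, hy, by simpa only [mul_comm] using hxy, hx⟩
    · refine ⟨Fin b ⊕ Fin (a - b) ⊕ Fin (c - b), inferInstance,
        Sum.elim 1 (Sum.elim 1 0), Sum.elim 1 (Sum.elim 0 1), ?_, ?_, ?_⟩ <;>
      simp [hab, hcb]

theorem two_by_two_dnn_integer_cp (a b c : ℕ) (h : b ^ 2 ≤ a * c) :
    ∃ (k : ℕ) (B : Matrix (Fin 2) (Fin k) ℕ), B * Bᵀ = !![a, b; b, c] := by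
  obtain ⟨ι, _, x, y, hx, hxy, hy⟩ := exists_nat_vectors_of_sq_le_mul b a c h
  let e := (Fintype.equivFin ι).symm
  refine ⟨Fintype.card ι, Matrix.of ![x ∘ e, y ∘ e], ?_⟩
  rw [← e.sum_comp] at hx hxy hy
  ext i j
  fin_cases i <;> fin_cases j <;> simp [Matrix.mul_apply, hx, hxy, hy]
  simpa only [mul_comm] using hxy
end

section
/- If u : Fin k → ℕ is a spanning vector and m ∈ ℕ satisfies m ≤ (∑ i, (u i)^2) + 1, then the vector of length k+1 obtained by appending the entry m to u is also a spanning vector. -/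
/-- A vector `u : Fin n → ℕ` is spanning if every `b ≤ ∑ i, (u i)^2` can be written
as `∑ i, (v i) * (u i)` for some `v` with `v i ≤ u i` for all `i`. -/
def Spanning {n : ℕ} (u : Fin n → ℕ) : Prop :=
  ∀ b : ℕ, b ≤ ∑ i, (u i) ^ 2 →
    ∃ v : Fin n → ℕ, (∀ i, v i ≤ u i) ∧ ∑ i, (v i) * (u i) = b

/-- Division with remainder by `m`, with the quotient capped at `m`. -/
theorem exists_le_mul_add_eq {S m b : ℕ} (hm : m ≤ S + 1) (hb : b ≤ S + m ^ 2) :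
    ∃ q r : ℕ, q ≤ m ∧ r ≤ S ∧ r + q * m = b := by
  rcases le_total (m ^ 2) b with h | h
  · exact ⟨m, b - m ^ 2, le_rfl, by omega, by rw [← sq]; omega⟩
  · rcases Nat.eq_zero_or_pos m with rfl | hpos
    · exact ⟨0, b, le_rfl, by simpa using hb, by simp⟩
    · refine ⟨b / m, b % m, ?_, ?_, Nat.mod_add_div' b m⟩
      · exact Nat.div_le_of_le_mul (by rwa [← sq])
      · have := Nat.mod_lt b hpos
        omega

theorem spanning_snoc {k : ℕ} (u : Fin k → ℕ) (hu : Spanning u)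
    (m : ℕ) (hm : m ≤ (∑ i, (u i) ^ 2) + 1) :
    Spanning (Fin.snoc u m) := by
  intro b hb
  simp only [Fin.sum_univ_castSucc, Fin.snoc_castSucc, Fin.snoc_last] at hb
  obtain ⟨q, r, hq, hr, rfl⟩ := exists_le_mul_add_eq hm hb
  obtain ⟨v, hv, rfl⟩ := hu r hr
  refine ⟨Fin.snoc v q, fun i => ?_, ?_⟩
  · refine Fin.lastCases ?_ (fun j => ?_) i
    · simpa using hq
    · simpa using hv j
  · simp [Fin.sum_univ_castSucc]
end

section
/- Every step vector is spanning: if u : Fin n → ℕ (n ≥ 1) satisfies u 0 = 1 and u (i+1) - u i ∈ {0, 1} for all consecutive indices, then for every natural number b with b ≤ ∑ i, (u i)^2 there exists v : Fin n → ℕ with v i ≤ u i for all i and ∑ i, (v i) * (u i) = b. -/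
/-- If `m ≤ S + 1`, any `b ≤ S + m ^ 2` is the sum of a number at most `S` and a multiple `k * m`
with `k ≤ m`. -/
theorem exists_le_add_mul_eq {S m b : ℕ} (hm : m ≤ S + 1) (hb : b ≤ S + m ^ 2) :
    ∃ c k : ℕ, c ≤ S ∧ k ≤ m ∧ c + k * m = b := by
  rcases le_total (m ^ 2) b with h | h
  · exact ⟨b - m ^ 2, m, by omega, le_rfl, by rw [← sq]; omega⟩
  · rcases Nat.eq_zero_or_pos m with rfl | hpos
    · exact ⟨b, 0, by simpa using hb, le_rfl, by simp⟩
    · have hmod := Nat.mod_lt b hpos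
      refine ⟨b % m, b / m, by omega, Nat.div_le_of_le_mul (by rwa [← sq]), ?_⟩
      rw [mul_comm]
      exact Nat.mod_add_div b m

theorem step_vector_spanning {n : ℕ} (hn : 1 ≤ n) (u : Fin n → ℕ)
    (h0 : u ⟨0, hn⟩ = 1)
    (hstep : ∀ i : ℕ, ∀ hi : i + 1 < n,
      ((u ⟨i + 1, hi⟩ : ℤ) - (u ⟨i, Nat.lt_of_succ_lt hi⟩ : ℤ)) ∈ ({0, 1} : Set ℤ)) :
    ∀ b : ℕ, b ≤ ∑ i, (u i) ^ 2 →
      ∃ v : Fin n → ℕ, (∀ i, v i ≤ u i) ∧ ∑ i, (v i) * (u i) = b := by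
  induction n, hn using Nat.le_induction with
  | base =>
    intro b hb
    have h0' : u 0 = 1 := h0
    refine ⟨fun _ ↦ b, fun i ↦ ?_, ?_⟩
    · rw [Subsingleton.elim i 0]
      simpa [h0'] using hb
    · simp [h0']
  | succ n hn ih =>
    intro b hb
    rw [Fin.sum_univ_castSucc] at hb
    have hlast : u (Fin.last n) ≤ ∑ i : Fin n, u i.castSucc ^ 2 + 1 := by
      obtain ⟨k, rfl⟩ : ∃ k, n = k + 1 := ⟨n - 1, by omega⟩
      have hs : u (Fin.last (k + 1)) ≤ u (Fin.last k).castSucc + 1 := by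
        have h := hstep k (by omega)
        simp only [Set.mem_insert_iff, Set.mem_singleton_iff] at h
        change (u (Fin.last (k + 1)) : ℤ) - u (Fin.last k).castSucc = 0 ∨
          (u (Fin.last (k + 1)) : ℤ) - u (Fin.last k).castSucc = 1 at h
        omega
      have hsq := Finset.single_le_sum (f := fun i : Fin (k + 1) ↦ u i.castSucc ^ 2)
        (fun _ _ ↦ Nat.zero_le _) (Finset.mem_univ (Fin.last k))
      have hle := Nat.le_self_pow two_ne_zero (u (Fin.last k).castSucc)
      exact hs.trans (Nat.succ_le_succ (hle.trans hsq))
    obtain ⟨c, k, hc, hk, rfl⟩ := exists_le_add_mul_eq hlast hb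
    obtain ⟨v, hv, hvc⟩ := ih (fun i ↦ u i.castSucc) h0 (fun i hi ↦ hstep i (by omega)) c hc
    refine ⟨Fin.snoc (α := fun _ ↦ ℕ) v k, fun i ↦ ?_, ?_⟩
    · refine Fin.lastCases ?_ (fun j ↦ ?_) i
      · simpa using hk
      · simpa using hv j
    · simp [Fin.sum_univ_castSucc, hvc]
end

section
/- Every natural number n with n % 8 ∈ {1, 2, 3, 5, 6} can be written as a sum of three perfect squares: there exist x, y, z ∈ ℕ with n = x^2 + y^2 + z^2. -/
/-- Every integer is congruent modulo `a > 0` to an integer of absolute value at most `a / 2`. -/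
lemma exists_two_mul_abs_add_mul_le {a : ℤ} (ha : 0 < a) (b : ℤ) :
    ∃ k : ℤ, 2 * |b + k * a| ≤ a := by
  refine ⟨-((2 * b + a) / (2 * a)), ?_⟩
  have h₁ := Int.emod_nonneg (2 * b + a) (by lia : 2 * a ≠ 0)
  have h₂ := Int.emod_lt_of_pos (2 * b + a) (by lia : 0 < 2 * a)
  have h₃ := Int.emod_add_mul_ediv (2 * b + a) (2 * a)
  set q := (2 * b + a) / (2 * a)
  have h₄ : |2 * (b + -q * a)| ≤ a := abs_le.2 ⟨by linarith, by linarith⟩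
  rwa [abs_mul, abs_two] at h₄

lemma four_mul_sq_le_of_two_mul_abs_le {a b : ℤ} (h : 2 * |b| ≤ a) : 4 * b ^ 2 ≤ a ^ 2 := by
  nlinarith [sq_abs b, abs_nonneg b]

/-- A positive definite binary form of determinant `D` is properly equivalent to a form whose
leading coefficient `A` satisfies `3 * A ^ 2 ≤ 4 * D`. -/
lemma exists_binary_form_reduction {D : ℤ} (hD : 0 < D) (A B C : ℤ) (hA : 0 < A)
    (h : A * C - B ^ 2 = D) :
    ∃ p q r s : ℤ, p * s - q * r = 1 ∧ 0 < A * p ^ 2 + 2 * B * p * r + C * r ^ 2 ∧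
      3 * (A * p ^ 2 + 2 * B * p * r + C * r ^ 2) ^ 2 ≤ 4 * D := by
  induction hN : A.toNat using Nat.strong_induction_on generalizing A B C with
  | _ N ih =>
    by_cases hred : 3 * A ^ 2 ≤ 4 * D
    · exact ⟨1, 0, 0, 1, by norm_num, by simpa, by simpa⟩
    obtain ⟨k, hk⟩ := exists_two_mul_abs_add_mul_le hA B
    have hk' := four_mul_sq_le_of_two_mul_abs_le hk
    have hdet : A * (A * k ^ 2 + 2 * B * k + C) = D + (B + k * A) ^ 2 := by
      rw [← h]; ring
    have hpos : 0 < A * k ^ 2 + 2 * B * k + C := by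
      refine pos_of_mul_pos_right (?_ : 0 < A * _) hA.le
      rw [hdet]; positivity
    have hlt : A * k ^ 2 + 2 * B * k + C < A := by
      refine lt_of_mul_lt_mul_left ?_ hA.le
      rw [hdet]; nlinarith
    obtain ⟨p, q, r, s, h₁, h₂, h₃⟩ := ih _ (by lia) (A * k ^ 2 + 2 * B * k + C)
      (-(B + k * A)) A hpos (by linear_combination hdet) rfl
    have hval : A * (k * p - r) ^ 2 + 2 * B * (k * p - r) * p + C * p ^ 2 =
        (A * k ^ 2 + 2 * B * k + C) * p ^ 2 + 2 * (-(B + k * A)) * p * r + A * r ^ 2 := by ring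
    refine ⟨k * p - r, k * q - s, p, q, by linear_combination h₁, ?_, ?_⟩
    · rwa [hval]
    · rwa [hval]

/-- A positive definite integral binary form of determinant one only takes values that are sums of
two squares. -/
lemma binary_form_eq_sq_add_sq {a b c : ℤ} (ha : 0 < a) (h : a * c - b ^ 2 = 1) (x y : ℤ) :
    ∃ u v : ℤ, a * x ^ 2 + 2 * b * x * y + c * y ^ 2 = u ^ 2 + v ^ 2 := by
  obtain ⟨p, q, r, s, h₁, h₂, h₃⟩ := exists_binary_form_reduction one_pos a b c ha h
  have hone : a * p ^ 2 + 2 * b * p * r + c * r ^ 2 = 1 := by nlinarith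
  have hx : x = p * (s * x - q * y) + q * (p * y - r * x) := by linear_combination -x * h₁
  have hy : y = r * (s * x - q * y) + s * (p * y - r * x) := by linear_combination -y * h₁
  set X := s * x - q * y
  set Y := p * y - r * x
  -- the middle coefficient of the form in the coordinates `X`, `Y`
  set β := a * p * q + b * (p * s + q * r) + c * r * s with hβ
  have hdet : a * q ^ 2 + 2 * b * q * s + c * s ^ 2 = 1 + β ^ 2 := by
    have : (a * p ^ 2 + 2 * b * p * r + c * r ^ 2) * (a * q ^ 2 + 2 * b * q * s + c * s ^ 2)
        - β ^ 2 = (a * c - b ^ 2) * (p * s - q * r) ^ 2 := by rw [hβ]; ring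
    rw [hone, h, h₁] at this
    linarith
  refine ⟨X + β * Y, Y, ?_⟩
  rw [hx, hy]
  linear_combination X ^ 2 * hone + Y ^ 2 * hdet - 2 * X * Y * hβ

/-- A positive definite integral ternary form of determinant one only takes values that are sums of
three squares. -/
lemma ternary_form_eq_sum_three_squares (a b c d e f : ℤ) (ha : 0 < a) (hab : 0 < a * b - f ^ 2)
    (h : a * b * c + 2 * d * e * f - a * d ^ 2 - b * e ^ 2 - c * f ^ 2 = 1) (x y z : ℤ) :
    ∃ u v w : ℤ, a * x ^ 2 + b * y ^ 2 + c * z ^ 2 + 2 * d * y * z + 2 * e * x * z + 2 * f * x * y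
      = u ^ 2 + v ^ 2 + w ^ 2 := by
  induction hN : a.toNat using Nat.strong_induction_on generalizing a b c d e f x y z with
  | _ N ih =>
    obtain rfl | ha₁ : a = 1 ∨ 2 ≤ a := by lia
    · obtain ⟨u, v, huv⟩ := binary_form_eq_sq_add_sq (a := b - f ^ 2) (b := d - e * f)
        (c := c - e ^ 2) (by linarith) (by linear_combination h) y z
      exact ⟨x + f * y + e * z, u, v, by linear_combination huv⟩
    obtain ⟨p, q, r, s, h₁, h₂, h₃⟩ := exists_binary_form_reduction ha (a * b - f ^ 2)
      (a * d - e * f) (a * c - e ^ 2) hab (by linear_combination a * h)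
    set A := (a * b - f ^ 2) * p ^ 2 + 2 * (a * d - e * f) * p * r + (a * c - e ^ 2) * r ^ 2 with hA
    obtain ⟨k, hk⟩ := exists_two_mul_abs_add_mul_le ha (f * p + e * r)
    have hk' := four_mul_sq_le_of_two_mul_abs_le hk
    set F := f * p + e * r + k * a with hF
    set M := a * k ^ 2 + b * p ^ 2 + c * r ^ 2 + 2 * d * p * r + 2 * e * k * r + 2 * f * k * p
      with hM
    have hmul : a * M = F ^ 2 + A := by rw [hM, hF, hA]; ring
    have hpos : 0 < M := by
      refine pos_of_mul_pos_right (?_ : 0 < a * M) ha.le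
      rw [hmul]; positivity
    have hAlt : 4 * A < 3 * a ^ 2 := by
      by_contra! hcon
      nlinarith [mul_pos ha ha, pow_pos ha 3, pow_pos ha 2,
        mul_le_mul hcon hcon (by positivity) (by positivity)]
    have hlt : M < a := by
      refine lt_of_mul_lt_mul_left ?_ ha.le
      rw [hmul]; linarith
    have hx : x = k * (s * y - q * z) + (x - k * (s * y - q * z)) := by ring
    have hy : y = p * (s * y - q * z) + q * (p * z - r * y) := by linear_combination -y * h₁
    have hz : z = r * (s * y - q * z) + s * (p * z - r * y) := by linear_combination -z * h₁
    set X := s * y - q * z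
    set Y := x - k * X
    set Z := p * z - r * y
    obtain ⟨u, v, w, huvw⟩ := ih _ (by lia) M a (b * q ^ 2 + c * s ^ 2 + 2 * d * q * s)
      (f * q + e * s) (b * p * q + c * r * s + d * (p * s + q * r) + e * k * s + f * k * q) F
      hpos (by linarith) (by
        rw [hM, hF]
        linear_combination (p * s - q * r) ^ 2 * h + (p * s - q * r + 1) * h₁) X Y Z rfl
    refine ⟨u, v, w, ?_⟩
    rw [← huvw, hM, hF, hx, hy, hz]
    ring

/-- If `-b` is a square modulo `b * n - 1` for some `b > 0`, then `n` is a sum of three squares. -/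
lemma sum_three_squares_of_dvd_sq_add {n : ℕ} {b m : ℤ} (hb : 0 < b) (hbn : 1 < b * n)
    (h : b * n - 1 ∣ m ^ 2 + b) : ∃ x y z : ℕ, n = x ^ 2 + y ^ 2 + z ^ 2 := by
  obtain ⟨a, ha⟩ := h
  have ha₀ : 0 < a := by
    refine pos_of_mul_pos_right (?_ : 0 < (b * n - 1) * a) (by linarith)
    rw [← ha]; positivity
  obtain ⟨u, v, w, h⟩ := ternary_form_eq_sum_three_squares a (b * n - 1) n 0 1 m ha₀
    (by linarith) (by linear_combination -n * ha) 0 0 1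
  refine ⟨u.natAbs, v.natAbs, w.natAbs, ?_⟩
  zify
  simpa using h

lemma exists_dvd_sq_add_of_jacobiSym_neg_eq_one {p : ℕ} (hp : p.Prime) {b : ℤ}
    (h : jacobiSym (-b) p = 1) : ∃ m : ℤ, (p : ℤ) ∣ m ^ 2 + b := by
  have : Fact p.Prime := ⟨hp⟩
  obtain ⟨m, hm⟩ := ZMod.isSquare_of_jacobiSym_eq_one h
  obtain ⟨m, rfl⟩ := ZMod.intCast_surjective m
  refine ⟨m, (ZMod.intCast_zmod_eq_zero_iff_dvd _ p).1 ?_⟩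
  push_cast at hm ⊢
  linear_combination -hm

/-- Dirichlet's theorem, with the prime written as a term of the progression. -/
lemma exists_prime_eq_mul_add {q a : ℕ} (hq : q ≠ 0) (h : a.Coprime q) :
    ∃ v : ℕ, (q * v + a).Prime := by
  obtain ⟨p, hlt, hp, hmod⟩ := Nat.forall_exists_prime_gt_and_modEq a hq h
  obtain ⟨v, hv⟩ := (Nat.modEq_iff_dvd' hlt.le).1 hmod.symm
  exact ⟨v, by rwa [← hv, Nat.sub_add_cancel hlt.le]⟩

lemma sum_three_squares_of_mod_four_eq_two {n : ℕ} (hn : n % 4 = 2) :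
    ∃ x y z : ℕ, n = x ^ 2 + y ^ 2 + z ^ 2 := by
  have hcop : (n - 1).Coprime (4 * n) := by
    refine Nat.Coprime.mul_right ?_ ?_
    · exact Nat.Coprime.pow_right 2 (Nat.coprime_two_right.2 (Nat.odd_iff.2 (by lia)))
    · exact (Nat.coprime_self_sub_left (by lia)).2 (Nat.coprime_one_left n)
  obtain ⟨v, hp⟩ := exists_prime_eq_mul_add (by lia) hcop
  set p := 4 * n * v + (n - 1) with hpdef
  have hpb : (p : ℤ) = (4 * v + 1 : ℕ) * n - 1 := by
    rw [hpdef]; push_cast [Nat.cast_sub (by lia : 1 ≤ n)]; ring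
  have hp4 : p % 4 = 1 := by
    rw [hpdef, mul_assoc, Nat.mul_add_mod]; lia
  have hpodd : Odd p := Nat.odd_iff.2 (Nat.odd_of_mod_four_eq_one hp4)
  have hodd : Odd (4 * v + 1) := ⟨2 * v, by ring⟩
  have hb4 : (4 * v + 1) % 4 = 1 := by lia
  have hjac : jacobiSym (-((4 * v + 1 : ℕ) : ℤ)) p = 1 := by
    rw [jacobiSym.neg _ hpodd, ZMod.χ₄_nat_one_mod_four hp4, one_mul,
      jacobiSym.quadratic_reciprocity_one_mod_four hb4 hpodd,
      jacobiSym.mod_left' (a₂ := -1), jacobiSym.at_neg_one hodd, ZMod.χ₄_nat_one_mod_four hb4]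
    rw [hpb, sub_eq_add_neg, Int.mul_add_emod_self_left]
  obtain ⟨m, hm⟩ := exists_dvd_sq_add_of_jacobiSym_neg_eq_one hp hjac
  rw [hpb] at hm
  refine sum_three_squares_of_dvd_sq_add (by positivity) ?_ hm
  have := hp.pos
  lia

/-- The residue `c` of `b` modulo `8` is `1` or `3`, chosen so that `(b * n - 1) / 2` is odd; the
last hypothesis makes the signs in quadratic reciprocity cancel. -/
lemma sum_three_squares_of_odd {n c : ℕ} (hn : 0 < n) (hc : c = 1 ∨ c = 3) (hcn : c * n % 4 = 3)
    (h : c = 1 → c * n % 8 = 3) :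
    ∃ x y z : ℕ, n = x ^ 2 + y ^ 2 + z ^ 2 := by
  obtain ⟨t, ht⟩ : ∃ t, c * n = 2 * t + 1 := ⟨c * n / 2, by lia⟩
  have hcop : t.Coprime (4 * n) := by
    refine Nat.Coprime.mul_right ?_ ?_
    · exact Nat.Coprime.pow_right 2 (Nat.coprime_two_right.2 (Nat.odd_iff.2 (by lia)))
    · refine Nat.isCoprime_iff_coprime.1 ⟨-2, c, ?_⟩
      zify at ht
      linear_combination ht
  obtain ⟨v, hp⟩ := exists_prime_eq_mul_add (by lia) hcop
  set p := 4 * n * v + t with hpdef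
  set b := 8 * v + c with hb
  have hpb : 2 * (p : ℤ) = b * n - 1 := by
    rw [hpdef, hb]; zify at ht; push_cast; linear_combination -ht
  have hb8 : b % 8 = c := by lia
  have hbodd : Odd b := Nat.odd_iff.2 (by lia)
  have hp4 : p % 4 = t % 4 := by
    rw [hpdef, mul_assoc]; lia
  have hpodd : Odd p := Nat.odd_iff.2 (by lia)
  have hJ2 : jacobiSym (-2) b = 1 := by
    rw [jacobiSym.at_neg_two hbodd, ZMod.χ₈'_nat_eq_if_mod_eight, hb8, Nat.odd_iff.1 hbodd]
    rcases hc with rfl | rfl <;> rfl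
  have hJp : jacobiSym p b = 1 := by
    have hmul : jacobiSym (-2 * p) b = 1 := by
      rw [jacobiSym.mod_left' (a₂ := 1), jacobiSym.one_left]
      rw [show -2 * (p : ℤ) = b * (-n) + 1 by linear_combination -hpb,
        Int.mul_add_emod_self_left]
    rwa [jacobiSym.mul_left, hJ2, one_mul] at hmul
  have hjac : jacobiSym (-(b : ℤ)) p = 1 := by
    rw [jacobiSym.neg _ hpodd]
    obtain hp1 | hp3 : p % 4 = 1 ∨ p % 4 = 3 := by lia
    · rw [ZMod.χ₄_nat_one_mod_four hp1, one_mul,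
        jacobiSym.quadratic_reciprocity_one_mod_four' hbodd hp1, hJp]
    · rw [ZMod.χ₄_nat_three_mod_four hp3,
        jacobiSym.quadratic_reciprocity_three_mod_four (by lia) hp3, hJp]
      norm_num
  obtain ⟨m, hm⟩ := exists_dvd_sq_add_of_jacobiSym_neg_eq_one hp hjac
  obtain ⟨m', hm', hm'odd⟩ : ∃ m' : ℤ, (p : ℤ) ∣ m' ^ 2 + b ∧ Odd m' := by
    rcases Int.even_or_odd m with he | ho
    · refine ⟨m + p, ?_, he.add_odd (mod_cast hpodd)⟩
      rw [show (m + p) ^ 2 + (b : ℤ) = m ^ 2 + b + p * (2 * m + p) by ring]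
      exact dvd_add hm (dvd_mul_right _ _)
    · exact ⟨m, hm, ho⟩
  have htwo : (2 : ℤ) ∣ m' ^ 2 + b :=
    (hm'odd.pow.add_odd (mod_cast hbodd : Odd (b : ℤ))).two_dvd
  have hcop2 : IsCoprime (2 : ℤ) p :=
    Nat.isCoprime_iff_coprime.2 (Nat.coprime_two_left.2 hpodd)
  have hdvd := hcop2.mul_dvd htwo hm'
  rw [hpb] at hdvd
  refine sum_three_squares_of_dvd_sq_add (by lia) ?_ hdvd
  have := hp.pos
  lia

theorem good_number_sum_three_squares (n : ℕ)
    (h : n % 8 ∈ ({1, 2, 3, 5, 6} : Set ℕ)) :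
    ∃ x y z : ℕ, n = x ^ 2 + y ^ 2 + z ^ 2 := by
  simp only [Set.mem_insert_iff, Set.mem_singleton_iff] at h
  obtain h | h | h : n % 4 = 2 ∨ n % 8 = 3 ∨ n % 4 = 1 := by lia
  · exact sum_three_squares_of_mod_four_eq_two h
  · exact sum_three_squares_of_odd (c := 1) (by lia) (by lia) (by lia) (by lia)
  · exact sum_three_squares_of_odd (c := 3) (by lia) (by lia) (by lia) (by lia)
end

section
/- (Legendre's three-square theorem) A natural number n can be written as a sum of three perfect squares, n = x^2 + y^2 + z^2 with x, y, z ∈ ℕ, if and only if n is not of the form 4^k * (8*m + 7) for some k, m ∈ ℕ. -/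
/-- Every integer has a representative of absolute value at most `a / 2` modulo `a`. -/
lemma exists_abs_two_mul_add_mul_le (d : ℤ) {a : ℤ} (ha : 0 < a) :
    ∃ k : ℤ, |2 * (d + k * a)| ≤ a := by
  have h0 := Int.emod_nonneg d ha.ne'
  have h1 := Int.emod_lt_of_pos d ha
  have h2 := Int.emod_add_mul_ediv d a
  by_cases h : 2 * (d % a) ≤ a
  · refine ⟨-(d / a), ?_⟩
    rw [abs_le]
    constructor <;> linarith
  · refine ⟨-(d / a) - 1, ?_⟩
    rw [abs_le]
    constructor <;> linarith

/-- A reduced positive definite integral ternary form of determinant `1` is diagonal up to one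
shear. -/
lemma ternary_reduced_eq {a b c d e f : ℤ} (ha : 0 < a) (hg : 0 < a * b - d ^ 2)
    (hdet : a * b * c + 2 * d * e * f - a * f ^ 2 - b * e ^ 2 - c * d ^ 2 = 1)
    (hd : |2 * d| ≤ a) (hf : |2 * (a * f - d * e)| ≤ a * b - d ^ 2)
    (hab : a ≤ b) (hbc : a * b - d ^ 2 ≤ a * c - e ^ 2) :
    a = 1 ∧ b = 1 ∧ d = 0 ∧ f = 0 ∧ c = e ^ 2 + 1 := by
  have hd2 : (2 * d) ^ 2 ≤ a ^ 2 := sq_le_sq.2 (hd.trans (le_abs_self a))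
  have hf2 : (2 * (a * f - d * e)) ^ 2 ≤ (a * b - d ^ 2) ^ 2 := sq_le_sq.2 (hf.trans (le_abs_self _))
  have hkey : (a * b - d ^ 2) * (a * c - e ^ 2) = (a * f - d * e) ^ 2 + a := by
    linear_combination a * hdet
  obtain ⟨g, hgdef⟩ : ∃ g, g = a * b - d ^ 2 := ⟨_, rfl⟩
  rw [← hgdef] at hg hf hf2 hkey hbc
  have h1 : 3 * g ^ 2 ≤ 4 * a := by nlinarith
  have h2 : 3 * a ^ 2 ≤ 4 * g := by nlinarith
  have ha1 : a = 1 := by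
    by_contra hne
    have h3 : 2 ≤ a := by omega
    have h4 : 3 * a ≤ 2 * g := by nlinarith
    nlinarith
  subst ha1
  have hg1 : g = 1 := by nlinarith
  subst hg1
  have hd0 : d = 0 := by rw [abs_le] at hd; omega
  subst hd0
  have hf0 : f = 0 := by rw [abs_le] at hf; omega
  subst hf0
  have hb : b = 1 := by linarith
  subst hb
  refine ⟨rfl, rfl, rfl, rfl, by linarith⟩

/-- A positive definite integral ternary form of determinant `1` represents only sums of three
squares. -/
lemma sum_three_sq_of_ternary {N : ℤ} (s : ℕ) : ∀ {a b c d e f x y z : ℤ}, 0 < a →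
    0 < a * b - d ^ 2 → a * b * c + 2 * d * e * f - a * f ^ 2 - b * e ^ 2 - c * d ^ 2 = 1 →
    N = a * x ^ 2 + b * y ^ 2 + c * z ^ 2 + 2 * d * x * y + 2 * e * x * z + 2 * f * y * z →
    a + (a * b - d ^ 2) = s → ∃ u v w : ℤ, N = u ^ 2 + v ^ 2 + w ^ 2 := by
  induction s using Nat.strong_induction_on with
  | _ s ih =>
  intro a b c d e f x y z ha hg hdet hN hs
  obtain ⟨k, hk⟩ := exists_abs_two_mul_add_mul_le d ha
  obtain ⟨b', hb'⟩ : ∃ b', b' = b + 2 * k * d + k ^ 2 * a := ⟨_, rfl⟩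
  obtain ⟨d', hd'⟩ : ∃ d', d' = d + k * a := ⟨_, rfl⟩
  obtain ⟨f₁, hf₁⟩ : ∃ f₁, f₁ = f + k * e := ⟨_, rfl⟩
  have hgg : a * b' - d' ^ 2 = a * b - d ^ 2 := by subst hb' hd'; ring
  rw [← hd'] at hk
  rw [← hgg] at hg hs
  obtain ⟨m, hm⟩ := exists_abs_two_mul_add_mul_le (a * f₁ - d' * e) hg
  obtain ⟨c', hc'⟩ : ∃ c', c' = c + 2 * m * f₁ + m ^ 2 * b' := ⟨_, rfl⟩
  obtain ⟨e', he'⟩ : ∃ e', e' = e + m * d' := ⟨_, rfl⟩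
  obtain ⟨f', hf'⟩ : ∃ f', f' = f₁ + m * b' := ⟨_, rfl⟩
  have hm' : |2 * (a * f' - d' * e')| ≤ a * b' - d' ^ 2 := by
    convert hm using 3
    subst hf' he'
    ring
  have hdet' : a * b' * c' + 2 * d' * e' * f' - a * f' ^ 2 - b' * e' ^ 2 - c' * d' ^ 2 = 1 := by
    rw [← hdet]
    subst hf' he' hc' hf₁ hd' hb'
    ring
  obtain ⟨y', hy'⟩ : ∃ y', y' = y - m * z := ⟨_, rfl⟩
  obtain ⟨x', hx'⟩ : ∃ x', x' = x - k * y := ⟨_, rfl⟩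
  have hN' : N = a * x' ^ 2 + b' * y' ^ 2 + c' * z ^ 2 + 2 * d' * x' * y' + 2 * e' * x' * z
      + 2 * f' * y' * z := by
    rw [hN]
    subst hx' hy' hf' he' hc' hf₁ hd' hb'
    ring
  by_cases hab : a ≤ b'
  · by_cases hbc : a * b' - d' ^ 2 ≤ a * c' - e' ^ 2
    · obtain ⟨h1, h2, h3, h4, h5⟩ := ternary_reduced_eq ha hg hdet' hk hm' hab hbc
      refine ⟨x' + e' * z, y', z, ?_⟩
      rw [hN', h1, h2, h3, h4, h5]
      ring
    · have hkey : (a * b' - d' ^ 2) * (a * c' - e' ^ 2) = (a * f' - d' * e') ^ 2 + a := by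
        linear_combination a * hdet'
      have hpos : 0 < a * c' - e' ^ 2 := by
        refine pos_of_mul_pos_right (a := a * b' - d' ^ 2) ?_ hg.le
        rw [hkey]
        positivity
      refine ih (a + (a * c' - e' ^ 2)).toNat (by omega) (a := a) (b := c') (c := b') (d := e')
        (e := d') (f := f') (x := x') (y := z) (z := y') ha hpos ?_ ?_ (by omega)
      · rw [← hdet']; ring
      · rw [hN']; ring
  · have hb0 : 0 < b' := by
      refine pos_of_mul_pos_right (a := a) ?_ ha.le
      nlinarith [sq_nonneg d']
    have hcomm : b' * a - d' ^ 2 = a * b' - d' ^ 2 := by ring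
    refine ih (b' + (b' * a - d' ^ 2)).toNat (by omega) (a := b') (b := a) (c := c') (d := d')
      (e := f') (f := e') (x := y') (y := x') (z := z) hb0 (by omega) ?_ ?_ (by omega)
    · rw [← hdet']; ring
    · rw [hN']; ring

/-- If `-d` is a square modulo `d * n - 1`, then `n` is a sum of three squares. -/
lemma sum_three_sq_of_dvd {n d t : ℤ} (hd : 0 < d) (hdn : 0 < d * n - 1)
    (h : d * n - 1 ∣ t ^ 2 + d) : ∃ u v w : ℤ, n = u ^ 2 + v ^ 2 + w ^ 2 := by
  obtain ⟨a, ha⟩ := h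
  have ha0 : 0 < a := by
    refine pos_of_mul_pos_right (a := d * n - 1) ?_ hdn.le
    rw [← ha]
    positivity
  have hdisc : a * (d * n - 1) - t ^ 2 = d := by linear_combination -ha
  refine sum_three_sq_of_ternary (a + (a * (d * n - 1) - t ^ 2)).toNat (a := a) (b := d * n - 1)
    (c := n) (d := t) (e := 1) (f := 0) (x := 0) (y := 0) (z := 1) ha0 (by rwa [hdisc]) ?_ (by ring)
    (by omega)
  linear_combination n * hdisc

open NumberTheorySymbols in
/-- A Jacobi symbol equal to `1` at a prime yields a square root modulo that prime. -/
lemma exists_dvd_sq_add_of_jacobiSym {p : ℕ} (hp : p.Prime) {d : ℤ} (h : J(-d | p) = 1) :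
    ∃ t : ℤ, (p : ℤ) ∣ t ^ 2 + d := by
  have := Fact.mk hp
  obtain ⟨r, hr⟩ := ZMod.isSquare_of_jacobiSym_eq_one h
  refine ⟨r.val, ?_⟩
  rw [← ZMod.intCast_zmod_eq_zero_iff_dvd]
  push_cast at hr ⊢
  rw [ZMod.natCast_zmod_val]
  linear_combination -hr

/-- A square root of `-d` modulo an odd `p` lifts to one modulo `2 * p` when `d` is odd. -/
lemma exists_two_mul_dvd_sq_add {p d t : ℤ} (hp : p % 2 = 1) (hd : d % 2 = 1)
    (h : p ∣ t ^ 2 + d) : ∃ t : ℤ, 2 * p ∣ t ^ 2 + d := by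
  obtain ⟨t, ht, hodd⟩ : ∃ t : ℤ, p ∣ t ^ 2 + d ∧ t % 2 = 1 := by
    rcases Int.emod_two_eq_zero_or_one t with h0 | h0
    · refine ⟨t + p, ?_, by omega⟩
      have heq : (t + p) ^ 2 + d = (t ^ 2 + d) + p * (2 * t + p) := by ring
      rw [heq]
      exact h.add (dvd_mul_right _ _)
    · exact ⟨t, h, h0⟩
  refine ⟨t, IsCoprime.mul_dvd ⟨-(p / 2), 1, by omega⟩ ?_ ht⟩
  have hsq : t ^ 2 % 2 = 1 := Int.odd_iff.1 ((Int.odd_iff.2 hodd).pow)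
  omega

open NumberTheorySymbols in
lemma sum_three_sq_of_mod_four_eq_two {n : ℕ} (hn : n % 4 = 2) :
    ∃ u v w : ℤ, (n : ℤ) = u ^ 2 + v ^ 2 + w ^ 2 := by
  have hcop : (n - 1).Coprime (4 * n) := by
    refine Nat.Coprime.mul_right ?_ ?_
    · exact Nat.Coprime.pow_right 2 (Nat.coprime_two_right.2 (Nat.odd_iff.2 (by omega)))
    · obtain ⟨m, rfl⟩ : ∃ m, n = m + 1 := ⟨n - 1, by omega⟩
      simp
  obtain ⟨p, hpn, hp, hmod⟩ :=
    Nat.forall_exists_prime_gt_and_modEq n (q := 4 * n) (by omega) hcop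
  obtain ⟨j, hj⟩ := (Nat.modEq_iff_dvd' (by omega)).1 hmod.symm
  obtain ⟨d, hd⟩ : ∃ d, d = 4 * j + 1 := ⟨_, rfl⟩
  have hpd : p + 1 = d * n := by
    have : p = 4 * n * j + (n - 1) := by omega
    have h1 : d * n = 4 * n * j + n := by rw [hd]; ring
    omega
  have hp4 : p % 4 = 1 := by
    have : (p + 1) % 4 = 2 := by rw [hpd, Nat.mul_mod, hn, hd]; omega
    omega
  have hdo : Odd d := Nat.odd_iff.2 (by omega)
  have hpo : Odd p := Nat.odd_iff.2 (by omega)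
  have hJ : J(-(d : ℤ) | p) = 1 := by
    rw [jacobiSym.neg _ hpo, ZMod.χ₄_nat_one_mod_four hp4, one_mul,
      jacobiSym.quadratic_reciprocity_one_mod_four' hdo hp4,
      jacobiSym.mod_left' (a₂ := -1), jacobiSym.at_neg_one hdo,
      ZMod.χ₄_nat_one_mod_four (by omega)]
    exact Int.ModEq.symm ((Int.modEq_iff_dvd).2 ⟨n, by rw [sub_neg_eq_add]; exact_mod_cast hpd⟩)
  obtain ⟨t, ht⟩ := exists_dvd_sq_add_of_jacobiSym hp hJ
  have hpd' : (d : ℤ) * n - 1 = p := by rw [sub_eq_iff_eq_add]; exact_mod_cast hpd.symm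
  refine sum_three_sq_of_dvd (d := d) (t := t) (by omega) ?_ (by rwa [hpd'])
  rw [hpd']
  exact_mod_cast hp.pos

open NumberTheorySymbols in
/-- If `2 * p = d * n - 1`, then `-d` is a square modulo the odd prime `p` under suitable
congruence conditions on `d` and `p`. -/
lemma jacobiSym_neg_eq_one {n d p : ℕ} (hpd : 2 * p + 1 = d * n) (hd : d % 8 = 1 ∨ d % 8 = 3)
    (hp : p % 4 = 1 ∨ p % 4 = 3 ∧ d % 8 = 3) : J(-(d : ℤ) | p) = 1 := by
  have hdo : Odd d := Nat.odd_iff.2 (by omega)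
  have hpo : Odd p := Nat.odd_iff.2 (by omega)
  have hflip : J(-(d : ℤ) | p) = J(p | d) := by
    rw [jacobiSym.neg _ hpo]
    rcases hp with hp | ⟨hp, hd⟩
    · rw [ZMod.χ₄_nat_one_mod_four hp, one_mul,
        jacobiSym.quadratic_reciprocity_one_mod_four' hdo hp]
    · rw [ZMod.χ₄_nat_three_mod_four hp,
        jacobiSym.quadratic_reciprocity_three_mod_four (by omega) hp]
      ring
  have hneg_two : J(-2 | d) = 1 := by
    rw [jacobiSym.at_neg_two hdo, ZMod.χ₈'_nat_eq_if_mod_eight]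
    rcases hd with hd | hd <;> simp [hd] <;> omega
  have hprod : J(-2 * p | d) = 1 := by
    rw [jacobiSym.mod_left' (a₂ := 1), jacobiSym.one_left]
    exact Int.modEq_iff_dvd.2 ⟨n, by zify at hpd; linarith⟩
  rwa [jacobiSym.mul_left, hneg_two, one_mul, ← hflip] at hprod

/-- The odd case, using a prime `p` with `2 * p = d * n - 1` and `d` congruent to `c`
modulo `8`. -/
lemma sum_three_sq_of_odd {n c : ℕ} (h : c = 1 ∧ n % 8 = 3 ∨ c = 3 ∧ n % 4 = 1) :
    ∃ u v w : ℤ, (n : ℤ) = u ^ 2 + v ^ 2 + w ^ 2 := by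
  obtain ⟨m, hm⟩ : ∃ m, 2 * m + 1 = c * n := by
    refine ⟨c * n / 2, ?_⟩
    rcases h with ⟨rfl, h⟩ | ⟨rfl, h⟩ <;> omega
  have hmo : m % 2 = 1 := by
    rcases h with ⟨rfl, h⟩ | ⟨rfl, h⟩ <;> omega
  have hcop : m.Coprime (4 * n) := by
    refine Nat.Coprime.mul_right ?_ ?_
    · exact Nat.Coprime.pow_right 2 (Nat.coprime_two_right.2 (Nat.odd_iff.2 hmo))
    · rw [← Nat.isCoprime_iff_coprime]
      exact ⟨-2, c, by zify at hm; linarith⟩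
  obtain ⟨p, hpm, hp, hmod⟩ :=
    Nat.forall_exists_prime_gt_and_modEq m (q := 4 * n) (by omega) hcop
  obtain ⟨j, hj⟩ := (Nat.modEq_iff_dvd' hpm.le).1 hmod.symm
  have hpj : p = 4 * (n * j) + m := by
    rw [← mul_assoc]
    omega
  obtain ⟨d, hd⟩ : ∃ d, d = 8 * j + c := ⟨_, rfl⟩
  have hpd : 2 * p + 1 = d * n := by
    rw [hd, add_mul, ← hm, hpj]
    ring
  obtain ⟨t, ht⟩ := exists_dvd_sq_add_of_jacobiSym hp
    (jacobiSym_neg_eq_one hpd (by omega)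
      (by rcases h with ⟨rfl, h⟩ | ⟨rfl, h⟩ <;> omega))
  obtain ⟨t, ht⟩ := exists_two_mul_dvd_sq_add (by omega) (by omega) ht
  have hpd' : (d : ℤ) * n - 1 = 2 * p := by
    rw [sub_eq_iff_eq_add]
    exact_mod_cast hpd.symm
  refine sum_three_sq_of_dvd (d := d) (t := t) (by omega) ?_ (by rwa [hpd'])
  have := hp.pos
  omega

/-- Among natural numbers not divisible by `4`, those not congruent to `7` modulo `8` are sums of
three integer squares. -/
lemma sum_three_sq_of_not_four_dvd {n : ℕ} (h4 : n % 4 ≠ 0) (h8 : n % 8 ≠ 7) :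
    ∃ u v w : ℤ, (n : ℤ) = u ^ 2 + v ^ 2 + w ^ 2 := by
  by_cases h2 : n % 4 = 2
  · exact sum_three_sq_of_mod_four_eq_two h2
  by_cases h1 : n % 4 = 1
  · exact sum_three_sq_of_odd (c := 3) (by omega)
  · exact sum_three_sq_of_odd (c := 1) (by omega)

lemma sq_mod_eight (x : ℕ) :
    x % 2 = 0 ∧ x ^ 2 % 8 = 0 ∨ x % 2 = 0 ∧ x ^ 2 % 8 = 4 ∨ x % 2 = 1 ∧ x ^ 2 % 8 = 1 := by
  rw [Nat.pow_mod]
  have hx : x % 8 < 8 := Nat.mod_lt _ (by norm_num)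
  have h2 : x % 2 = x % 8 % 2 := by omega
  rw [h2]
  generalize x % 8 = a at *
  interval_cases a <;> simp

lemma even_of_sum_three_sq_mod_four {x y z : ℕ} (h : (x ^ 2 + y ^ 2 + z ^ 2) % 4 = 0) :
    x % 2 = 0 ∧ y % 2 = 0 ∧ z % 2 = 0 := by
  have hx := sq_mod_eight x
  have hy := sq_mod_eight y
  have hz := sq_mod_eight z
  omega

lemma sum_three_sq_mod_eight_ne_seven (x y z : ℕ) : (x ^ 2 + y ^ 2 + z ^ 2) % 8 ≠ 7 := by
  have hx := sq_mod_eight x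
  have hy := sq_mod_eight y
  have hz := sq_mod_eight z
  omega

lemma sum_three_sq_ne_four_pow_mul (k m : ℕ) :
    ∀ x y z : ℕ, x ^ 2 + y ^ 2 + z ^ 2 ≠ 4 ^ k * (8 * m + 7) := by
  induction k with
  | zero =>
    intro x y z h
    exact sum_three_sq_mod_eight_ne_seven x y z (by omega)
  | succ k ih =>
    intro x y z h
    rw [pow_succ' 4 k, mul_assoc] at h
    obtain ⟨hx, hy, hz⟩ := even_of_sum_three_sq_mod_four (x := x) (y := y) (z := z) (by omega)
    obtain ⟨a, rfl⟩ := Nat.dvd_of_mod_eq_zero hx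
    obtain ⟨b, rfl⟩ := Nat.dvd_of_mod_eq_zero hy
    obtain ⟨c, rfl⟩ := Nat.dvd_of_mod_eq_zero hz
    refine ih a b c ?_
    simp only [mul_pow] at h
    omega

theorem legendre_three_squares (n : ℕ) :
    (∃ x y z : ℕ, n = x ^ 2 + y ^ 2 + z ^ 2) ↔
      ¬ ∃ k m : ℕ, n = 4 ^ k * (8 * m + 7) := by
  constructor
  · rintro ⟨x, y, z, h⟩ ⟨k, m, h'⟩
    exact sum_three_sq_ne_four_pow_mul k m x y z (h ▸ h')
  · induction n using Nat.strong_induction_on with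
    | _ n ih =>
    intro h
    rcases Nat.eq_zero_or_pos n with rfl | hpos
    · exact ⟨0, 0, 0, rfl⟩
    by_cases h4 : n % 4 = 0
    · obtain ⟨m, rfl⟩ := Nat.dvd_of_mod_eq_zero h4
      obtain ⟨x, y, z, hxyz⟩ := ih m (by omega) fun ⟨k, l, hkl⟩ =>
        h ⟨k + 1, l, by rw [hkl]; ring⟩
      exact ⟨2 * x, 2 * y, 2 * z, by rw [hxyz]; ring⟩
    · obtain ⟨u, v, w, huvw⟩ := sum_three_sq_of_not_four_dvd h4 fun h8 =>
        h ⟨0, n / 8, by omega⟩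
      refine ⟨u.natAbs, v.natAbs, w.natAbs, ?_⟩
      zify
      simpa only [sq_abs] using huvw
end

section
/- (Maxfield–Minc) Every doubly nonnegative real matrix of order at most 4 is completely positive: if n ≤ 4 and A : Matrix (Fin n) (Fin n) ℝ is positive semidefinite with all entries nonnegative, then there exist k ∈ ℕ and B : Matrix (Fin n) (Fin k) ℝ with all entries nonnegative such that A = B * Bᵀ. -/
open Matrix

namespace Matrix

/-- A real matrix is completely positive if it factors as `B * Bᵀ` with `B` entrywise
nonnegative. -/
def IsCompletelyPositive {ι : Type*} (A : Matrix ι ι ℝ) : Prop :=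
  ∃ (k : ℕ) (B : Matrix ι (Fin k) ℝ), (∀ i j, 0 ≤ B i j) ∧ A = B * Bᵀ

section

variable {ι : Type*}

theorem isCompletelyPositive_zero : IsCompletelyPositive (0 : Matrix ι ι ℝ) :=
  ⟨0, 0, by simp, by simp⟩

theorem IsCompletelyPositive.add_smul_vecMulVec {A : Matrix ι ι ℝ} (hA : A.IsCompletelyPositive)
    {t : ℝ} (ht : 0 ≤ t) {b : ι → ℝ} (hb : 0 ≤ b) :
    (A + t • vecMulVec b b).IsCompletelyPositive := by
  obtain ⟨k, B, hB, rfl⟩ := hA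
  refine ⟨k + 1, of fun i ↦ Fin.cons (√t * b i) (B i), fun i j ↦ ?_, ?_⟩
  · refine Fin.cases ?_ (fun j ↦ ?_) j
    · simpa using mul_nonneg (Real.sqrt_nonneg t) (hb i)
    · simpa using hB i j
  · ext i j
    simp only [add_apply, smul_apply, vecMulVec_apply, smul_eq_mul, mul_apply, transpose_apply,
      of_apply, Fin.sum_univ_succ, Fin.cons_zero, Fin.cons_succ]
    linear_combination (-(b i * b j)) * Real.mul_self_sqrt ht

variable [Fintype ι]

theorem PosSemidef.dotProduct_mulVec_comm {A : Matrix ι ι ℝ} (hA : A.PosSemidef) (x y : ι → ℝ) :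
    x ⬝ᵥ (A *ᵥ y) = y ⬝ᵥ (A *ᵥ x) := by
  have hT : Aᵀ = A := by simpa [conjTranspose_eq_transpose_of_trivial] using hA.isHermitian.eq
  rw [dotProduct_mulVec, ← mulVec_transpose, hT, dotProduct_comm]

theorem PosSemidef.dotProduct_mulVec_self_nonneg {A : Matrix ι ι ℝ} (hA : A.PosSemidef)
    (x : ι → ℝ) : 0 ≤ x ⬝ᵥ (A *ᵥ x) := by
  simpa using hA.dotProduct_mulVec_nonneg x

theorem PosSemidef.dotProduct_mulVec_sq_le {A : Matrix ι ι ℝ} (hA : A.PosSemidef) (x y : ι → ℝ) :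
    (x ⬝ᵥ (A *ᵥ y)) ^ 2 ≤ (x ⬝ᵥ (A *ᵥ x)) * (y ⬝ᵥ (A *ᵥ y)) := by
  have h : discrim (x ⬝ᵥ (A *ᵥ x)) (2 * (x ⬝ᵥ (A *ᵥ y))) (y ⬝ᵥ (A *ᵥ y)) ≤ 0 := by
    refine discrim_le_zero fun s ↦ ?_
    have := hA.dotProduct_mulVec_self_nonneg (s • x + y)
    simp only [mulVec_add, mulVec_smul, dotProduct_add, add_dotProduct, smul_dotProduct,
      dotProduct_smul, smul_eq_mul] at this
    linarith [hA.dotProduct_mulVec_comm x y, congrArg (s * ·) (hA.dotProduct_mulVec_comm x y)]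
  rw [discrim] at h
  linarith

theorem PosSemidef.sub_smul_vecMulVec {A : Matrix ι ι ℝ} (hA : A.PosSemidef) {x : ι → ℝ} {t : ℝ}
    (ht : 0 ≤ t) (htx : t * (x ⬝ᵥ (A *ᵥ x)) ≤ 1) :
    (A - t • vecMulVec (A *ᵥ x) (A *ᵥ x)).PosSemidef := by
  refine .of_dotProduct_mulVec_nonneg ?_ fun y ↦ ?_
  · refine hA.isHermitian.sub ?_
    ext i j
    simp [vecMulVec_apply, mul_comm]
  · have h := hA.dotProduct_mulVec_sq_le x y
    have hc := hA.dotProduct_mulVec_comm x y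
    have hy := hA.dotProduct_mulVec_self_nonneg y
    simp only [star_trivial, sub_mulVec, smul_mulVec, vecMulVec_mulVec, dotProduct_sub,
      dotProduct_smul, op_smul_eq_smul, smul_eq_mul]
    rw [dotProduct_comm (A *ᵥ x) y, ← hc]
    nlinarith [mul_le_mul_of_nonneg_left h ht, mul_le_mul_of_nonneg_right htx hy]

theorem range_mulVecLin_sub_smul_vecMulVec_le (A : Matrix ι ι ℝ) (x c : ι → ℝ) (t : ℝ) :
    (A - t • vecMulVec (A *ᵥ x) c).mulVecLin.range ≤ A.mulVecLin.range := by
  rintro _ ⟨y, rfl⟩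
  refine ⟨y - (t * (c ⬝ᵥ y)) • x, ?_⟩
  simp only [mulVecLin_apply, mulVec_sub, sub_mulVec, smul_mulVec, vecMulVec_mulVec, mulVec_smul,
    op_smul_eq_smul, smul_smul]

theorem PosSemidef.rank_sub_smul_vecMulVec_lt {A : Matrix ι ι ℝ} (hA : A.PosSemidef)
    {x : ι → ℝ} {t : ℝ} (htx : t * (x ⬝ᵥ (A *ᵥ x)) = 1) :
    (A - t • vecMulVec (A *ᵥ x) (A *ᵥ x)).rank < A.rank := by
  refine Submodule.finrank_lt_finrank_of_lt <|
    (range_mulVecLin_sub_smul_vecMulVec_le A x _ t).lt_of_not_ge fun hle ↦ ?_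
  obtain ⟨y, hy⟩ := hle ⟨x, rfl⟩
  have h := congrArg (x ⬝ᵥ ·) hy
  simp only [mulVecLin_apply, sub_mulVec, smul_mulVec, vecMulVec_mulVec, dotProduct_sub,
    dotProduct_smul, op_smul_eq_smul, smul_eq_mul] at h
  rw [dotProduct_comm (A *ᵥ x) y, hA.dotProduct_mulVec_comm y x] at h
  have h0 : x ⬝ᵥ (A *ᵥ x) = 0 := by linear_combination -h - (x ⬝ᵥ (A *ᵥ y)) * htx
  simp [h0] at htx

/-- If the range of every nonzero doubly nonnegative matrix contains a nonzero nonnegative vector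
whose support is a clique in the graph of the matrix, then doubly nonnegative matrices are
completely positive. -/
theorem PosSemidef.isCompletelyPositive_of_exists_clique
    (h : ∀ A : Matrix ι ι ℝ, A.PosSemidef → (∀ i j, 0 ≤ A i j) → A ≠ 0 →
      ∃ x, 0 ≤ A *ᵥ x ∧ A *ᵥ x ≠ 0 ∧
        ∀ i j, 0 < (A *ᵥ x) i → 0 < (A *ᵥ x) j → 0 < A i j)
    (A : Matrix ι ι ℝ) (hA : A.PosSemidef) (hA0 : ∀ i j, 0 ≤ A i j) :
    A.IsCompletelyPositive := by
  classical
  induction hN : A.rank + (Finset.univ.filter fun p : ι × ι ↦ A p.1 p.2 ≠ 0).card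
    using Nat.strong_induction_on generalizing A with
  | _ N ih =>
  subst hN
  by_cases hAz : A = 0
  · exact hAz ▸ isCompletelyPositive_zero
  obtain ⟨x, hb0, hbne, hcl⟩ := h A hA hA0 hAz
  set b := A *ᵥ x with hb
  have hγ : 0 < x ⬝ᵥ b := by
    refine (hA.dotProduct_mulVec_self_nonneg x).lt_of_ne' fun h0 ↦ hbne ?_
    exact (hA.dotProduct_mulVec_zero_iff x).1 (by simpa using h0)
  obtain ⟨i₀, hi₀⟩ : ∃ i, 0 < b i := by
    by_contra! hle
    exact hbne (le_antisymm hle hb0)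
  obtain ⟨⟨p, q⟩, hpq, hmin⟩ := Finset.exists_min_image
    (Finset.univ.filter fun p : ι × ι ↦ 0 < b p.1 ∧ 0 < b p.2)
    (fun p ↦ A p.1 p.2 / (b p.1 * b p.2)) ⟨(i₀, i₀), by simp [hi₀]⟩
  simp only [Finset.mem_filter, Finset.mem_univ, true_and, Prod.forall] at hpq hmin
  have hbpq : 0 < b p * b q := mul_pos hpq.1 hpq.2
  have hApq : 0 < A p q := hcl p q hpq.1 hpq.2
  set t := min (A p q / (b p * b q)) (1 / (x ⬝ᵥ b)) with ht
  have ht0 : 0 ≤ t := le_min (by positivity) (by positivity)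
  have htx : t * (x ⬝ᵥ b) ≤ 1 := (le_div_iff₀ hγ).1 (min_le_right _ _)
  have hzero : ∀ i j, b i = 0 ∨ b j = 0 ∨ 0 < b i ∧ 0 < b j := fun i j ↦ by
    rcases (hb0 i).eq_or_lt with hi | hi
    · exact .inl hi.symm
    rcases (hb0 j).eq_or_lt with hj | hj
    · exact .inr (.inl hj.symm)
    exact .inr (.inr ⟨hi, hj⟩)
  have hentry : ∀ i j, (A - t • vecMulVec b b) i j = A i j - t * (b i * b j) := fun i j ↦ by
    simp [vecMulVec_apply]
  have hnn : ∀ i j, 0 ≤ (A - t • vecMulVec b b) i j := fun i j ↦ by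
    rw [hentry]
    rcases hzero i j with h0 | h0 | hij
    · simpa [h0] using hA0 i j
    · simpa [h0] using hA0 i j
    · have := (min_le_left _ _ : t ≤ _).trans (hmin i j hij)
      rw [le_div_iff₀ (mul_pos hij.1 hij.2)] at this
      linarith
  have hsupp : (Finset.univ.filter fun p : ι × ι ↦ (A - t • vecMulVec b b) p.1 p.2 ≠ 0) ⊆
      Finset.univ.filter fun p : ι × ι ↦ A p.1 p.2 ≠ 0 := by
    rintro ⟨i, j⟩
    simp only [Finset.mem_filter, Finset.mem_univ, true_and, hentry]
    intro hne
    rcases hzero i j with h0 | h0 | hij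
    · simpa [h0] using hne
    · simpa [h0] using hne
    · exact (hcl i j hij.1 hij.2).ne'
  have hrank : (A - t • vecMulVec b b).rank ≤ A.rank :=
    Submodule.finrank_mono (range_mulVecLin_sub_smul_vecMulVec_le A x b t)
  have hlt : (A - t • vecMulVec b b).rank +
      (Finset.univ.filter fun p : ι × ι ↦ (A - t • vecMulVec b b) p.1 p.2 ≠ 0).card <
      A.rank + (Finset.univ.filter fun p : ι × ι ↦ A p.1 p.2 ≠ 0).card := by
    rcases min_choice (A p q / (b p * b q)) (1 / (x ⬝ᵥ b)) with hm | hm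
    · refine add_lt_add_of_le_of_lt hrank (Finset.card_lt_card ?_)
      refine (Finset.ssubset_iff_of_subset hsupp).2 ⟨(p, q), by simpa using hApq.ne', ?_⟩
      simp only [Finset.mem_filter, Finset.mem_univ, true_and, hentry, not_not]
      rw [ht, hm, div_mul_cancel₀ _ hbpq.ne', sub_self]
    · refine add_lt_add_of_lt_of_le ?_ (Finset.card_le_card hsupp)
      exact hA.rank_sub_smul_vecMulVec_lt (by rw [ht, hm, ← hb, one_div_mul_cancel hγ.ne'])
  have hrec := ih _ hlt _ (hA.sub_smul_vecMulVec ht0 htx) hnn rfl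
  simpa only [← hb, sub_add_cancel] using hrec.add_smul_vecMulVec ht0 hb0

theorem PosSemidef.sq_apply_le [DecidableEq ι] {A : Matrix ι ι ℝ} (hA : A.PosSemidef) (i j : ι) :
    A i j ^ 2 ≤ A i i * A j j := by
  simpa using hA.dotProduct_mulVec_sq_le (Pi.single i 1) (Pi.single j 1)

end

theorem mul_apply_nonneg {l m n : Type*} [Fintype m] {A : Matrix l m ℝ} {B : Matrix m n ℝ}
    (hA : ∀ i j, 0 ≤ A i j) (hB : ∀ i j, 0 ≤ B i j) (i : l) (j : n) : 0 ≤ (A * B) i j := by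
  rw [mul_apply]
  exact Finset.sum_nonneg fun k _ ↦ mul_nonneg (hA i k) (hB k j)

/-- A nonzero `4 × 4` doubly nonnegative matrix has in its range a nonzero nonnegative vector
supported on a clique of its graph. -/
theorem PosSemidef.exists_clique_fin_four {A : Matrix (Fin 4) (Fin 4) ℝ} (hA : A.PosSemidef)
    (hA0 : ∀ i j, 0 ≤ A i j) (hne : A ≠ 0) :
    ∃ x, 0 ≤ A *ᵥ x ∧ A *ᵥ x ≠ 0 ∧
      ∀ i j, 0 < (A *ᵥ x) i → 0 < (A *ᵥ x) j → 0 < A i j := by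
  have hsymm : ∀ i j, A i j = A j i := fun i j ↦ by simpa using hA.isHermitian.apply j i
  have hdiag : ∀ i j, 0 < A i j → 0 < A i i := fun i j hij ↦ by
    refine (hA0 i i).lt_of_ne' fun h0 ↦ ?_
    have := hA.sq_apply_le i j
    rw [h0, zero_mul] at this
    exact (pow_pos hij 2).not_ge this
  by_contra! hcon
  -- no vertex is simplicial
  have hns : ∀ i, 0 < A i i → ∃ j k, 0 < A i j ∧ 0 < A i k ∧ A j k = 0 := fun i hi ↦ by
    obtain ⟨j, k, hj, hk, hjk⟩ := hcon (Pi.single i 1)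
      (fun j ↦ by simpa using hA0 j i) (fun h0 ↦ hi.ne' (by simpa using congrFun h0 i))
    exact ⟨j, k, by simpa [hsymm i] using hj, by simpa [hsymm i] using hk,
      le_antisymm hjk (hA0 j k)⟩
  obtain ⟨i, m, him⟩ : ∃ i m, 0 < A i m := by
    by_contra! hle
    exact hne (ext fun i j ↦ le_antisymm (hle i j) (hA0 i j))
  obtain ⟨j, k, hij, hik, hjk⟩ := hns i (hdiag i m him)
  have hii := hdiag i j hij
  have hjj := hdiag j i (hsymm i j ▸ hij)
  have hkk := hdiag k i (hsymm i k ▸ hik)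
  -- the graph is the four-cycle `i j l k`
  have hne_ij : i ≠ j := by rintro rfl; exact hik.ne' hjk
  have hne_ik : i ≠ k := by rintro rfl; exact hij.ne' (hsymm i j ▸ hjk)
  have hne_jk : j ≠ k := by rintro rfl; exact hjj.ne' hjk
  obtain ⟨l, hcover⟩ : ∃ l, ∀ m, m = i ∨ m = j ∨ m = k ∨ m = l := by
    clear * - hne_ij hne_ik hne_jk
    revert i j k
    decide
  obtain ⟨hjl, hil⟩ : 0 < A j l ∧ A i l = 0 := by
    obtain ⟨p, q, hp, hq, hpq⟩ := hns j hjj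
    have hp' := hdiag p j (hsymm j p ▸ hp)
    have hq' := hdiag q j (hsymm j q ▸ hq)
    have hp_cover := hcover p
    have hq_cover := hcover q
    clear hns hcon hdiag hcover
    rcases hp_cover with rfl | rfl | rfl | rfl <;> rcases hq_cover with rfl | rfl | rfl | rfl <;>
      grind
  have hkl : 0 < A k l := by
    obtain ⟨p, q, hp, hq, hpq⟩ := hns k hkk
    have hp' := hdiag p k (hsymm k p ▸ hp)
    have hq' := hdiag q k (hsymm k q ▸ hq)
    have hp_cover := hcover p
    have hq_cover := hcover q
    clear hns hcon hdiag hcover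
    rcases hp_cover with rfl | rfl | rfl | rfl <;> rcases hq_cover with rfl | rfl | rfl | rfl <;>
      grind
  have hll := hdiag l k (hsymm k l ▸ hkl)
  have hminor : A i k ^ 2 * A l l ≤ A i i * (A l l * A k k - A k l ^ 2) := by
    have := hA.dotProduct_mulVec_self_nonneg
      (Pi.single i (A i k * A l l) + Pi.single l (A i i * A k l) + Pi.single k (-(A i i * A l l)))
    simp only [mulVec_add, dotProduct_add, add_dotProduct, single_dotProduct, mulVec_single,
      Pi.smul_apply, col_apply, op_smul_eq_smul, smul_eq_mul, hsymm k i, hsymm l i, hsymm l k,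
      hil] at this
    refine le_of_mul_le_mul_left ?_ (mul_pos hii hll)
    linarith
  have hΔ : 0 < A l l * A k k - A k l ^ 2 :=
    pos_of_mul_pos_right (lt_of_lt_of_le (by positivity) hminor) hii.le
  set x : Fin 4 → ℝ := Pi.single i (A l l * A k k - A k l ^ 2) + Pi.single l (A i k * A k l) +
    Pi.single k (-(A i k * A l l)) with hx
  have hAx : ∀ m, (A *ᵥ x) m = A m i * (A l l * A k k - A k l ^ 2) + A m l * (A i k * A k l) -
      A m k * (A i k * A l l) := fun m ↦ by
    simp only [hx, mulVec_add, mulVec_single, Pi.add_apply, Pi.smul_apply, col_apply,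
      op_smul_eq_smul, smul_eq_mul]
    ring
  have hxi : 0 ≤ (A *ᵥ x) i := by rw [hAx, hil]; linarith
  have hxj : 0 < (A *ᵥ x) j := by rw [hAx, hjk, hsymm j i]; simp; positivity
  have hxk : (A *ᵥ x) k = 0 := by rw [hAx, hsymm k i]; ring
  have hxl : (A *ᵥ x) l = 0 := by rw [hAx, hsymm l i, hil, hsymm l k]; ring
  obtain ⟨u, v, hu, hv, huv⟩ := hcon x
    (fun m ↦ by
      rcases hcover m with h | h | h | h <;> rw [h]
      exacts [hxi, hxj.le, hxk.ge, hxl.ge])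
    (fun h0 ↦ hxj.ne' (congrFun h0 j))
  have hedge : ∀ m, 0 < (A *ᵥ x) m → m = i ∨ m = j := fun m hm ↦ by
    rcases hcover m with h | h | h | h
    · exact .inl h
    · exact .inr h
    · exact absurd (h ▸ hxk) hm.ne'
    · exact absurd (h ▸ hxl) hm.ne'
  have hji := hsymm i j ▸ hij
  rcases hedge u hu with rfl | rfl <;> rcases hedge v hv with rfl | rfl <;> linarith

end Matrix

theorem maxfield_minc (n : ℕ) (hn : n ≤ 4) (A : Matrix (Fin n) (Fin n) ℝ)
    (hA : A.PosSemidef) (hnonneg : ∀ i j, 0 ≤ A i j) :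
    ∃ (k : ℕ) (B : Matrix (Fin n) (Fin k) ℝ), (∀ i j, 0 ≤ B i j) ∧ A = B * Bᵀ := by
  let P : Matrix (Fin 4) (Fin n) ℝ := (1 : Matrix (Fin 4) (Fin 4) ℝ).submatrix id (Fin.castLE hn)
  have hP : ∀ i j, 0 ≤ P i j := fun i j ↦ by
    simp only [P, submatrix_apply, one_apply]
    split_ifs <;> norm_num
  have hPP : Pᵀ * P = 1 := by
    rw [transpose_submatrix, ← submatrix_mul _ _ _ id _ Function.bijective_id]
    simp [submatrix_one _ (Fin.castLE_injective hn)]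
  obtain ⟨k, B, hB, hAB⟩ := PosSemidef.isCompletelyPositive_of_exists_clique
    (fun _ h h0 hne ↦ h.exists_clique_fin_four h0 hne) (P * A * Pᵀ)
    (by simpa [conjTranspose_eq_transpose_of_trivial] using hA.mul_mul_conjTranspose_same P)
    (mul_apply_nonneg (mul_apply_nonneg hP hnonneg) fun i j ↦ hP j i)
  refine ⟨k, Pᵀ * B, mul_apply_nonneg (fun i j ↦ hP j i) hB, ?_⟩
  calc A = (Pᵀ * P) * A * (Pᵀ * P) := by simp [hPP]
    _ = Pᵀ * (P * A * Pᵀ) * P := by simp only [Matrix.mul_assoc]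
    _ = Pᵀ * B * (Pᵀ * B)ᵀ := by simp only [hAB, transpose_mul, transpose_transpose, Matrix.mul_assoc]
end

section
/- The matrix A = !![1, 1, 1; 1, 2, 0; 1, 0, 2] is completely positive over the reals but not completely positive over the integers: there exist k ∈ ℕ and an entrywise nonnegative matrix B : Matrix (Fin 3) (Fin k) ℝ with B * Bᵀ = A, but there are no k ∈ ℕ and matrix C : Matrix (Fin 3) (Fin k) ℕ with C * Cᵀ = A. -/
open Matrix

theorem cp_real_not_cp_int :
    (∃ (k : ℕ) (B : Matrix (Fin 3) (Fin k) ℝ), (∀ i j, 0 ≤ B i j) ∧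
      B * Bᵀ = !![(1 : ℝ), 1, 1; 1, 2, 0; 1, 0, 2]) ∧
    ¬ ∃ (k : ℕ) (C : Matrix (Fin 3) (Fin k) ℕ),
      C * Cᵀ = !![(1 : ℕ), 1, 1; 1, 2, 0; 1, 0, 2] := by
  constructor
  · have h2 : √(2 : ℝ) * √2 = 2 := Real.mul_self_sqrt (by norm_num)
    refine ⟨2, !![√2 / 2, √2 / 2; √2, 0; 0, √2], ?_, ?_⟩
    · intro i j
      fin_cases i <;> fin_cases j <;> simp <;> positivity
    · ext i j
      fin_cases i <;> fin_cases j <;> simp [Matrix.mul_apply, Fin.sum_univ_two] <;> linarith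
  · rintro ⟨k, C, hC⟩
    have entry (i j : Fin 3) : ∑ l, C i l * C j l =
        !![(1 : ℕ), 1, 1; 1, 2, 0; 1, 0, 2] i j := by
      rw [← hC]; rfl
    have h00 : ∑ l, C 0 l * C 0 l = 1 := entry 0 0
    have h01 : ∑ l, C 0 l * C 1 l = 1 := entry 0 1
    have h02 : ∑ l, C 0 l * C 2 l = 1 := entry 0 2
    have h12 : ∑ l, C 1 l * C 2 l = 0 := entry 1 2
    obtain ⟨a, -, ha⟩ := Finset.exists_ne_zero_of_sum_ne_zero (h01.trans_ne one_ne_zero)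
    obtain ⟨b, -, hb⟩ := Finset.exists_ne_zero_of_sum_ne_zero (h02.trans_ne one_ne_zero)
    obtain ⟨ha0, ha1⟩ := mul_ne_zero_iff.mp ha
    obtain ⟨hb0, hb2⟩ := mul_ne_zero_iff.mp hb
    have hab : a ≠ b := by
      rintro rfl
      exact mul_ne_zero ha1 hb2 (Finset.sum_eq_zero_iff.mp h12 a (Finset.mem_univ a))
    have hle : ∑ l ∈ {a, b}, C 0 l * C 0 l ≤ ∑ l, C 0 l * C 0 l :=
      Finset.sum_le_sum_of_subset (Finset.subset_univ _)
    rw [Finset.sum_pair hab, h00] at hle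
    have := Nat.pos_of_ne_zero (mul_ne_zero ha0 ha0)
    have := Nat.pos_of_ne_zero (mul_ne_zero hb0 hb0)
    omega
end

section
/- The integer CP rank of the matrix !![8, 1; 1, 8] is greater than 8: for every k ≤ 8, there is no matrix B : Matrix (Fin 2) (Fin k) ℕ with B * Bᵀ = !![8, 1; 1, 8]. (Hence the bound 11 in the Laffey–Šmigoc theorem cannot be replaced by 8.) -/
open Matrix

/-- If natural numbers have squares summing to `8` and one of them equals `1`,
then at least five of them are nonzero. -/
lemma five_le_card_support_of_sum_sq_eq_eight {ι : Type*} [Fintype ι] (x : ι → ℕ)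
    (hx : ∑ j, x j * x j = 8) {i : ι} (hi : x i = 1) :
    5 ≤ ∑ j, if x j = 0 then 0 else 1 := by
  have hle : ∀ j, x j ≤ 2 := fun j => by
    have : x j * x j ≤ ∑ j, x j * x j :=
      Finset.single_le_sum (f := fun j => x j * x j) (fun _ _ => Nat.zero_le _)
        (Finset.mem_univ j)
    nlinarith
  have hsq : ∑ j, x j * x j = (∑ j, if x j = 1 then 1 else 0) +
      4 * ∑ j, if x j = 2 then 1 else 0 := by
    rw [Finset.mul_sum, ← Finset.sum_add_distrib]
    refine Finset.sum_congr rfl fun j _ => ?_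
    have := hle j
    interval_cases x j <;> rfl
  have hsupp : (∑ j, if x j = 0 then 0 else 1) = (∑ j, if x j = 1 then 1 else 0) +
      ∑ j, if x j = 2 then 1 else 0 := by
    rw [← Finset.sum_add_distrib]
    refine Finset.sum_congr rfl fun j _ => ?_
    have := hle j
    interval_cases x j <;> rfl
  have hpos : 1 ≤ ∑ j, if x j = 1 then 1 else 0 := by
    have := Finset.single_le_sum (f := fun j => if x j = 1 then 1 else 0)
      (fun _ _ => Nat.zero_le _) (Finset.mem_univ i)
    simpa only [hi, if_true] using this
  omega

theorem icpr_eight_one_one_eight_gt_eight :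
    ∀ k : ℕ, k ≤ 8 → ¬ ∃ B : Matrix (Fin 2) (Fin k) ℕ, B * Bᵀ = !![8, 1; 1, 8] := by
  rintro k hk ⟨B, hB⟩
  have hxx : ∑ j, B 0 j * B 0 j = 8 := by
    simpa [Matrix.mul_apply] using congrFun (congrFun hB 0) 0
  have hyy : ∑ j, B 1 j * B 1 j = 8 := by
    simpa [Matrix.mul_apply] using congrFun (congrFun hB 1) 1
  have hxy : ∑ j, B 0 j * B 1 j = 1 := by
    simpa [Matrix.mul_apply] using congrFun (congrFun hB 0) 1
  obtain ⟨i, -, hi⟩ : ∃ i ∈ Finset.univ, B 0 i * B 1 i ≠ 0 :=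
    Finset.exists_ne_zero_of_sum_ne_zero (by rw [hxy]; exact one_ne_zero)
  have hi_le : B 0 i * B 1 i ≤ 1 :=
    (Finset.single_le_sum (f := fun j => B 0 j * B 1 j) (fun _ _ => Nat.zero_le _)
      (Finset.mem_univ i)).trans_eq hxy
  obtain ⟨hx_one, hy_one⟩ : B 0 i = 1 ∧ B 1 i = 1 := mul_eq_one.mp (by omega)
  have hx := five_le_card_support_of_sum_sq_eq_eight (B 0) hxx hx_one
  have hy := five_le_card_support_of_sum_sq_eq_eight (B 1) hyy hy_one
  have hsum : (∑ j, if B 0 j = 0 then 0 else 1) + (∑ j, if B 1 j = 0 then 0 else 1) ≤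
      ∑ j, (1 + B 0 j * B 1 j) := by
    rw [← Finset.sum_add_distrib]
    refine Finset.sum_le_sum fun j _ => ?_
    split_ifs with h0 h1 h1
    · omega
    · omega
    · omega
    · have := Nat.mul_pos (Nat.pos_of_ne_zero h0) (Nat.pos_of_ne_zero h1)
      omega
  rw [Finset.sum_add_distrib, hxy] at hsum
  simp only [Finset.sum_const, Finset.card_univ, Fintype.card_fin, smul_eq_mul, mul_one] at hsum
  omega
end

section
/- If A = !![b, b; b, c] with b, c ∈ ℕ and c ≥ b, then A can be decomposed as A = B * Bᵀ where B is a 2×8 matrix with nonnegative integer entries, i.e., icpr(A) ≤ 8. (Indeed A = (c - b)·diag(0,1)-part plus b·J where J is the all-ones 2×2 matrix.) -/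
open Matrix

theorem icpr_bbbc_le_eight (b c : ℕ) (h : b ≤ c) :
    ∃ B : Matrix (Fin 2) (Fin 8) ℕ, B * Bᵀ = !![b, b; b, c] := by
  obtain ⟨d, rfl⟩ := Nat.exists_eq_add_of_le h
  obtain ⟨x, y, z, w, hb⟩ := Nat.sum_four_squares b
  obtain ⟨p, q, r, s, hd⟩ := Nat.sum_four_squares d
  refine ⟨!![x, y, z, w, 0, 0, 0, 0; x, y, z, w, p, q, r, s], ?_⟩
  ext i j
  fin_cases i <;> fin_cases j <;>
    simp [Matrix.mul_apply, Fin.sum_univ_eight, ← hb, ← hd] <;> ring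
end

section
/- If A = !![a, b; b, c] with a, b, c ∈ ℕ, a ≥ 1, and b^2 ≤ c, then A can be decomposed as A = B * Bᵀ where B is a 2×9 matrix with nonnegative integer entries, i.e., icpr(A) ≤ 9. (Indeed A = diag(a-1, c-b²) + !![1, b; b, b²].) -/
open Matrix

theorem icpr_le_nine_of_sq_le (a b c : ℕ) (ha : 1 ≤ a) (hb : b ^ 2 ≤ c) :
    ∃ B : Matrix (Fin 2) (Fin 9) ℕ, B * Bᵀ = !![a, b; b, c] := by
  obtain ⟨p, q, r, s, hp⟩ := Nat.sum_four_squares (a - 1)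
  obtain ⟨t, u, v, w, ht⟩ := Nat.sum_four_squares (c - b ^ 2)
  have h₁ : p ^ 2 + q ^ 2 + r ^ 2 + s ^ 2 + 1 = a := by omega
  have h₂ : t ^ 2 + u ^ 2 + v ^ 2 + w ^ 2 + b ^ 2 = c := by omega
  refine ⟨!![1, p, q, r, s, 0, 0, 0, 0; b, 0, 0, 0, 0, t, u, v, w], ?_⟩
  rw [← h₁, ← h₂]
  ext i j
  fin_cases i <;> fin_cases j <;> simp [Matrix.mul_apply, Fin.sum_univ_succ] <;> ring
end

section
/- For every natural number n with 1 ≤ n ≤ 64 and n ≠ 33, there exists a spanning vector u : Fin 5 → ℕ with ∑ i, (u i)^2 = n. -/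
theorem Spanning.vecCons {n : ℕ} {u : Fin n → ℕ} (hu : Spanning u) {x : ℕ}
    (hx : x ≤ ∑ i, (u i) ^ 2 + 1) : Spanning (Matrix.vecCons x u) := by
  intro b hb
  simp only [Fin.sum_univ_succ, Matrix.cons_val_zero, Matrix.cons_val_succ] at hb
  obtain ⟨k, hkx, hkb, hr⟩ :
      ∃ k, k ≤ x ∧ k * x ≤ b ∧ b - k * x ≤ ∑ i, (u i) ^ 2 := by
    rcases le_total (x * x) b with h | h
    · exact ⟨x, le_rfl, h, by rw [pow_two] at hb; omega⟩
    · refine ⟨b / x, Nat.div_le_of_le_mul h, Nat.div_mul_le_self b x, ?_⟩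
      rcases Nat.eq_zero_or_pos x with rfl | hpos
      · omega
      · have := Nat.mod_lt b hpos
        have := Nat.div_add_mod' b x
        omega
  obtain ⟨v, hv, hsum⟩ := hu _ hr
  refine ⟨Matrix.vecCons k v, Fin.cases hkx hv, ?_⟩
  simp only [Fin.sum_univ_succ, Matrix.cons_val_zero, Matrix.cons_val_succ, hsum]
  omega

theorem spanning_vecEmpty : Spanning (![] : Fin 0 → ℕ) := by
  intro b hb
  exact ⟨![], fun i => i.elim0, by simpa [eq_comm] using hb⟩

set_option synthInstance.maxSize 1000 in
theorem exists_sum_sq_eq_of_lt_65 : ∀ n < 65, 1 ≤ n → n ≠ 33 →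
    ∃ a ∈ Finset.range 2, ∃ b ∈ Finset.range 3, b ≤ a ^ 2 + 1 ∧ ∃ c ∈ Finset.range 5, c ≤ b ^ 2 + a ^ 2 + 1 ∧
      ∃ d ∈ Finset.range 6, d ≤ c ^ 2 + b ^ 2 + a ^ 2 + 1 ∧
        ∃ e ∈ Finset.range 8, e ≤ d ^ 2 + c ^ 2 + b ^ 2 + a ^ 2 + 1 ∧
          e ^ 2 + d ^ 2 + c ^ 2 + b ^ 2 + a ^ 2 = n := by
  decide +kernel

theorem spanning_vector_up_to_64 (n : ℕ) (h1 : 1 ≤ n) (h64 : n ≤ 64) (h33 : n ≠ 33) :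
    ∃ u : Fin 5 → ℕ, (∑ i, (u i) ^ 2 = n) ∧ Spanning u := by
  obtain ⟨a, ha, b, -, hb, c, -, hc, d, -, hd, e, -, he, hsum⟩ :=
    exists_sum_sq_eq_of_lt_65 n (Nat.lt_succ_of_le h64) h1 h33
  refine ⟨![e, d, c, b, a], ?_, ?_⟩
  · simpa [Fin.sum_univ_succ, add_assoc] using hsum
  · refine ((((spanning_vecEmpty.vecCons ?_).vecCons ?_).vecCons ?_).vecCons ?_).vecCons ?_ <;>
      simp [Fin.sum_univ_succ] at ha ⊢ <;> omega
end
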